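/- arXiv:2402.12547 — 3 statements merged into one kernel-verified Lean document; each statement's English description precedes it below -/
import Mathlib

section
/- Let n ≥ 4 be an integer and let G be the generalised quaternion group Q_{2^n} (QuaternionGroup 2^{n-2}) or the dihedral group D_{2^n} (DihedralGroup 2^{n-1}). Then the number of subgroups M of the permutation group Perm(G) such that M acts regularly on G, M is normalized by the image of the left-translation embedding λ : G → Perm(G), and M is isomorphic to the cyclic group Z/2^n Z, equals 2^{n-2}. (Equivalently: any Galois field extension of degree 2^n with Galois group G admits exactly 2^{n-2} Hopf–Galois structures of cyclic type C_{2^n}.) -/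
/-- A subgroup `M ≤ Perm G` is regular if for all `x y : G` there is exactly one
`π ∈ M` with `π x = y`. -/
def IsRegularPermSubgroup {G : Type} [Group G] (M : Subgroup (Equiv.Perm G)) : Prop :=
  ∀ x y : G, ∃! π : M, (π : Equiv.Perm G) x = y

/-- `M ≤ Perm G` is normalized by the image of the left-translation embedding. -/
def IsNormalizedByLeftTranslations {G : Type} [Group G] (M : Subgroup (Equiv.Perm G)) : Prop :=
  ∀ g : G, ∀ π ∈ M, (Equiv.mulLeft g) * π * (Equiv.mulLeft g)⁻¹ ∈ M

section Arith

theorem zm_even_or_unit (n : ℕ) (y : ZMod (2 ^ n)) : Even y ∨ IsUnit y := by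
  rcases Nat.even_or_odd y.val with h | h
  · left
    have := h.natCast (α := ZMod (2 ^ n))
    rwa [ZMod.natCast_zmod_val] at this
  · right
    have h2 : Nat.Coprime y.val (2 ^ n) := (Nat.coprime_two_right.mpr h).pow_right n
    have := (ZMod.isUnit_iff_coprime y.val (2 ^ n)).mpr h2
    rwa [ZMod.natCast_zmod_val] at this

theorem zm_not_even_unit (n : ℕ) (hn : n ≠ 0) (y : ZMod (2 ^ n)) (h : Even y)
    (hu : IsUnit y) : False := by
  let p : ZMod (2 ^ n) →+* ZMod 2 := ZMod.castHom (dvd_pow_self 2 hn) (ZMod 2)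
  have h1 : IsUnit (p y) := hu.map p
  obtain ⟨z, rfl⟩ := h
  rw [map_add, CharTwo.add_self_eq_zero] at h1
  exact not_isUnit_zero h1

theorem zm_unit_sub_one (n : ℕ) (hn : n ≠ 0) (y : ZMod (2 ^ n)) (hu : IsUnit y) :
    Even (y - 1) := by
  rcases Nat.even_or_odd y.val with h | h
  · have := h.natCast (α := ZMod (2 ^ n))
    rw [ZMod.natCast_zmod_val] at this
    exact (zm_not_even_unit n hn y this hu).elim
  · obtain ⟨k, hk⟩ := h
    refine ⟨(k : ZMod (2 ^ n)), ?_⟩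
    have : (y.val : ZMod (2 ^ n)) = ((2 * k + 1 : ℕ) : ZMod (2 ^ n)) := by rw [hk]
    rw [ZMod.natCast_zmod_val] at this
    rw [this]; push_cast; ring

theorem zm_pow_ne (n k : ℕ) (hk : k < n) : (2 : ZMod (2 ^ n)) ^ k ≠ 0 := by
  intro h
  have h2 : ((2 ^ k : ℕ) : ZMod (2 ^ n)) = 0 := by push_cast; exact h
  rw [ZMod.natCast_eq_zero_iff] at h2
  have := (Nat.pow_dvd_pow_iff_le_right (by norm_num : 1 < 2)).mp h2
  omega

end Arith

section Generic

/-- common presentation data of dihedral and quaternion groups -/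
structure DQ (G : Type) [Group G] (m : ℕ) where
  E : ZMod m ⊕ ZMod m ≃ G
  e : ZMod m
  he : e + e = 0
  one : E (.inl 0) = 1
  rr : ∀ i j, E (.inl i) * E (.inl j) = E (.inl (i + j))
  rx : ∀ i j, E (.inl i) * E (.inr j) = E (.inr (j - i))
  xr : ∀ i j, E (.inr i) * E (.inl j) = E (.inr (i + j))
  xx : ∀ i j, E (.inr i) * E (.inr j) = E (.inl (e + j - i))

variable {G : Type} [Group G] {m : ℕ}

/-- the basic permutation on the index set -/
def tauP (w : ZMod m) : Equiv.Perm (ZMod m ⊕ ZMod m) where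
  toFun := Sum.elim (fun k => .inr (-k)) (fun k => .inl (w - k))
  invFun := Sum.elim (fun k => .inr (w - k)) (fun k => .inl (-k))
  left_inv := by rintro (k | k) <;> simp
  right_inv := by rintro (k | k) <;> simp

/-- the transported permutation -/
def sigP (D : DQ G m) (w : ZMod m) : Equiv.Perm G := (D.E.symm.trans (tauP w)).trans D.E

theorem sigP_r (D : DQ G m) (w k : ZMod m) : sigP D w (D.E (.inl k)) = D.E (.inr (-k)) := by
  simp [sigP, tauP]

theorem sigP_x (D : DQ G m) (w k : ZMod m) : sigP D w (D.E (.inr k)) = D.E (.inl (w - k)) := by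
  simp [sigP, tauP]

theorem sigP_pow (D : DQ G m) (w : ZMod m) (j : ℕ) :
    (∀ k, (sigP D w ^ (2 * j)) (D.E (.inl k)) = D.E (.inl (k + j * w))) ∧
    (∀ k, (sigP D w ^ (2 * j)) (D.E (.inr k)) = D.E (.inr (k - j * w))) := by
  induction j with
  | zero => simp
  | succ j ih =>
    have h2 : 2 * (j + 1) = 2 * j + 1 + 1 := by ring
    constructor
    · intro k
      rw [h2, pow_succ, pow_succ, Equiv.Perm.mul_apply, Equiv.Perm.mul_apply, sigP_r, sigP_x, ih.1]
      push_cast; congr 2; ring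
    · intro k
      rw [h2, pow_succ, pow_succ, Equiv.Perm.mul_apply, Equiv.Perm.mul_apply, sigP_x, sigP_r, ih.2]
      push_cast; congr 2; ring

theorem sigP_orbit [NeZero m] (D : DQ G m) (w : (ZMod m)ˣ) (g : G) :
    ∃ j : ℕ, (sigP D (w : ZMod m) ^ j) 1 = g := by
  obtain ⟨y, rfl⟩ := D.E.surjective g
  have key : ∀ k : ZMod m, (((k * (w⁻¹ : (ZMod m)ˣ)).val : ℕ) : ZMod m) * (w : ZMod m) = k := by
    intro k
    rw [ZMod.natCast_zmod_val, mul_assoc, Units.inv_mul, mul_one]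
  rcases y with k | k
  · refine ⟨2 * (k * (w⁻¹ : (ZMod m)ˣ)).val, ?_⟩
    rw [← D.one, (sigP_pow D _ _).1, key, zero_add]
  · refine ⟨2 * ((-k) * (w⁻¹ : (ZMod m)ˣ)).val + 1, ?_⟩
    rw [pow_succ', Equiv.Perm.mul_apply, ← D.one, (sigP_pow D _ _).1, key, sigP_r]
    simp

/-- predicate of the statement -/
def Good (N : ℕ) (M : Subgroup (Equiv.Perm G)) : Prop :=
  IsRegularPermSubgroup M ∧ IsNormalizedByLeftTranslations M ∧
      Nonempty (M ≃* Multiplicative (ZMod N))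

theorem reg_eq {M : Subgroup (Equiv.Perm G)} (h : IsRegularPermSubgroup M)
    {p q : Equiv.Perm G} (hp : p ∈ M) (hq : q ∈ M) (x : G) (hx : p x = q x) : p = q := by
  have := (h x (q x)).unique (y₁ := ⟨p, hp⟩) (y₂ := ⟨q, hq⟩) hx rfl
  exact congrArg Subtype.val this

theorem zp_regular [NeZero m] (D : DQ G m) (w : (ZMod m)ˣ) :
    IsRegularPermSubgroup (Subgroup.zpowers (sigP D (w : ZMod m))) := by
  intro x y
  obtain ⟨i, hi⟩ := sigP_orbit D w x
  obtain ⟨j, hj⟩ := sigP_orbit D w y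
  refine ⟨⟨sigP D (w : ZMod m) ^ ((j : ℤ) - i), Subgroup.zpow_mem_zpowers _ _⟩, ?_, ?_⟩
  · change (sigP D (w : ZMod m) ^ ((j : ℤ) - i)) x = y
    rw [← hi, ← Equiv.Perm.mul_apply, ← zpow_natCast, ← zpow_add, sub_add_cancel, zpow_natCast, hj]
  · rintro ⟨p, a, rfl⟩ hp
    apply Subtype.ext
    change sigP D (w : ZMod m) ^ a = sigP D (w : ZMod m) ^ ((j : ℤ) - i)
    change (sigP D (w : ZMod m) ^ a) x = y at hp
    ext z
    obtain ⟨l, hl⟩ := sigP_orbit D w z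
    have e1 : ∀ b : ℤ, (sigP D (w : ZMod m) ^ b) z
        = (sigP D (w : ZMod m) ^ ((l : ℤ) - i)) ((sigP D (w : ZMod m) ^ b) x) := by
      intro b
      rw [← hi, ← hl]
      simp only [← Equiv.Perm.mul_apply, ← zpow_natCast, ← zpow_add]
      congr 2; ring
    rw [e1 a, e1 (j - i), hp]
    congr 1
    rw [← hi, ← Equiv.Perm.mul_apply, ← zpow_natCast, ← zpow_add, sub_add_cancel, zpow_natCast, hj]

theorem normz_mul {M : Subgroup (Equiv.Perm G)} {g h : G}
    (hg : ∀ π ∈ M, (Equiv.mulLeft g) * π * (Equiv.mulLeft g)⁻¹ ∈ M)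
    (hh : ∀ π ∈ M, (Equiv.mulLeft h) * π * (Equiv.mulLeft h)⁻¹ ∈ M) :
    ∀ π ∈ M, (Equiv.mulLeft (g * h)) * π * (Equiv.mulLeft (g * h))⁻¹ ∈ M := by
  intro π hπ
  have h1 : (Equiv.mulLeft (g * h) : Equiv.Perm G) = Equiv.mulLeft g * Equiv.mulLeft h := by
    ext z; simp [mul_assoc]
  have := hg _ (hh π hπ)
  rw [h1, mul_inv_rev]
  simpa only [mul_assoc] using this

theorem zp_norm_aux {s : Equiv.Perm G} {g : G}
    (h : ∃ p ∈ Subgroup.zpowers s, Equiv.mulLeft g * s = p * Equiv.mulLeft g) :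
    ∀ π ∈ Subgroup.zpowers s, (Equiv.mulLeft g) * π * (Equiv.mulLeft g)⁻¹ ∈ Subgroup.zpowers s := by
  rintro π ⟨a, rfl⟩
  obtain ⟨p, hp, h⟩ := h
  have : Equiv.mulLeft g * s * (Equiv.mulLeft g)⁻¹ = p := by rw [h, mul_inv_cancel_right]
  have h2 : Equiv.mulLeft g * s ^ a * (Equiv.mulLeft g)⁻¹ = p ^ a := by
    rw [← this, conj_zpow]
  change Equiv.mulLeft g * s ^ a * (Equiv.mulLeft g)⁻¹ ∈ _
  rw [h2]
  exact Subgroup.zpow_mem _ hp _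

theorem zp_norm [NeZero m] (D : DQ G m) (w : (ZMod m)ˣ) :
    IsNormalizedByLeftTranslations (Subgroup.zpowers (sigP D (w : ZMod m))) := by
  have hr : ∀ i, ∀ π ∈ Subgroup.zpowers (sigP D (w : ZMod m)),
      (Equiv.mulLeft (D.E (.inl i))) * π * (Equiv.mulLeft (D.E (.inl i)))⁻¹ ∈
        Subgroup.zpowers (sigP D (w : ZMod m)) := by
    intro i
    apply zp_norm_aux
    refine ⟨sigP D (w : ZMod m), Subgroup.mem_zpowers _, ?_⟩
    ext z
    obtain ⟨y, rfl⟩ := D.E.surjective z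
    rcases y with k | k
    · simp only [Equiv.Perm.mul_apply, Equiv.coe_mulLeft, sigP_r, sigP_x, D.rr, D.rx]
      congr 2; ring
    · simp only [Equiv.Perm.mul_apply, Equiv.coe_mulLeft, sigP_r, sigP_x, D.rr, D.rx]
      congr 2; ring
  have hx : ∀ π ∈ Subgroup.zpowers (sigP D (w : ZMod m)),
      (Equiv.mulLeft (D.E (.inr 0))) * π * (Equiv.mulLeft (D.E (.inr 0)))⁻¹ ∈
        Subgroup.zpowers (sigP D (w : ZMod m)) := by
    apply zp_norm_aux
    obtain ⟨j, hj⟩ : ∃ j : ℕ, (j : ZMod m) * w = D.e := by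
      refine ⟨(D.e * (w⁻¹ : (ZMod m)ˣ)).val, ?_⟩
      rw [ZMod.natCast_zmod_val, mul_assoc, Units.inv_mul, mul_one]
    refine ⟨(sigP D (w : ZMod m))⁻¹ * sigP D (w : ZMod m) ^ (2 * j),
      Subgroup.mul_mem _ (Subgroup.inv_mem _ (Subgroup.mem_zpowers _))
        (Subgroup.pow_mem _ (Subgroup.mem_zpowers _) _), ?_⟩
    rw [mul_assoc, eq_inv_mul_iff_mul_eq]
    have he : D.e = - D.e := eq_neg_of_add_eq_zero_left D.he
    ext z
    obtain ⟨y, rfl⟩ := D.E.surjective z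
    rcases y with k | k
    · simp only [Equiv.Perm.mul_apply, Equiv.coe_mulLeft, sigP_r, sigP_x, D.xr, D.xx,
        (sigP_pow D _ j).1, (sigP_pow D _ j).2, hj]
      congr 2; ring
    · simp only [Equiv.Perm.mul_apply, Equiv.coe_mulLeft, sigP_r, sigP_x, D.xr, D.xx,
        (sigP_pow D _ j).1, (sigP_pow D _ j).2, hj]
      congr 2; linear_combination (-1 : ZMod m) * D.he
  intro g
  obtain ⟨y, rfl⟩ := D.E.surjective g
  rcases y with k | k
  · exact hr k
  · have := normz_mul hx (hr k)
    rw [D.xr, zero_add] at this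
    exact this

theorem zp_good [NeZero m] (D : DQ G m) (w : (ZMod m)ˣ) :
    Good (2 * m) (Subgroup.zpowers (sigP D (w : ZMod m))) := by
  have hreg := zp_regular D w
  refine ⟨hreg, zp_norm D w, ?_⟩
  have hb : Function.Bijective
      (fun p : Subgroup.zpowers (sigP D (w : ZMod m)) => (p : Equiv.Perm G) 1) := by
    constructor
    · intro p q h
      exact Subtype.ext (reg_eq hreg p.2 q.2 1 h)
    · intro g
      obtain ⟨p, hp, _⟩ := hreg 1 g
      exact ⟨p, hp⟩
  have hc : Nat.card (Subgroup.zpowers (sigP D (w : ZMod m))) = 2 * m := by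
    rw [Nat.card_congr (Equiv.ofBijective _ hb), ← Nat.card_congr D.E, Nat.card_sum, Nat.card_zmod]
    ring
  exact ⟨mulEquivOfCyclicCardEq (by rw [hc, Nat.card_congr Multiplicative.toAdd, Nat.card_zmod])⟩

/-- data extracted from a good subgroup -/
theorem good_data {N : ℕ} [NeZero N] {M : Subgroup (Equiv.Perm G)} (h : Good N M) :
    ∃ (b c : G → ZMod N), Function.Bijective b ∧ (∀ g k, b (g * k) = b g + c g * b k) ∧
      (∀ g k, c (g * k) = c g * c k) ∧
      (∀ p ∈ M, ∀ g, b (p g) = b g + b (p 1)) := by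
  obtain ⟨hreg, hnorm, ⟨ee⟩⟩ := h
  let f : ZMod N → M := fun k => ee.symm (Multiplicative.ofAdd k)
  have fadd : ∀ k l, f (k + l) = f k * f l := by
    intro k l; simp [f]
  have finj : Function.Injective f := by
    intro k l h; simpa [f] using h
  have fsurj : ∀ p : M, ∃ k, f k = p := by
    intro p; exact ⟨(ee p).toAdd, by simp [f]⟩
  have hfreg : ∀ x k l, (f k : Equiv.Perm G) x = (f l : Equiv.Perm G) x → k = l := by
    intro x k l hkl
    exact finj (Subtype.ext (reg_eq hreg (f k).2 (f l).2 x hkl))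
  have hb : ∀ g : G, ∃ k, (f k : Equiv.Perm G) 1 = g := by
    intro g
    obtain ⟨p, hp, _⟩ := hreg 1 g
    obtain ⟨k, hk⟩ := fsurj p
    exact ⟨k, by rw [hk]; exact hp⟩
  choose b hb using hb
  have hc : ∀ g : G, ∃ c : ZMod N, ∀ k, 
      (Equiv.mulLeft g) * (f k : Equiv.Perm G) * (Equiv.mulLeft g)⁻¹ = (f (c * k) : Equiv.Perm G) := by
    intro g
    have h1 : ∀ k, ∃ l, (Equiv.mulLeft g) * (f k : Equiv.Perm G) * (Equiv.mulLeft g)⁻¹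
        = (f l : Equiv.Perm G) := by
      intro k
      obtain ⟨l, hl⟩ := fsurj ⟨_, hnorm g (f k) (f k).2⟩
      exact ⟨l, by rw [hl]⟩
    choose φ hφ using h1
    have hadd : ∀ k l, φ (k + l) = φ k + φ l := by
      intro k l
      apply finj
      apply Subtype.ext
      rw [← hφ, fadd, fadd, Subgroup.coe_mul, Subgroup.coe_mul, ← hφ, ← hφ]
      group
    let Φ : ZMod N →+ ZMod N := AddMonoidHom.mk' φ hadd
    refine ⟨φ 1, fun k => ?_⟩
    rw [hφ]
    congr 2
    have : Φ ((k.val : ℕ) • (1 : ZMod N)) = k.val • Φ 1 := map_nsmul Φ _ _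
    rw [nsmul_eq_mul, nsmul_eq_mul, ZMod.natCast_zmod_val, mul_one] at this
    rw [mul_comm]
    exact this
  choose c hc using hc
  have hbf : ∀ k, b ((f k : Equiv.Perm G) 1) = k := by
    intro k
    exact hfreg 1 _ _ (hb _)
  refine ⟨b, c, ⟨?_, ?_⟩, ?_, ?_, ?_⟩
  · intro x y hxy
    rw [← hb x, ← hb y, hxy]
  · intro k; exact ⟨_, hbf k⟩
  · intro g k
    apply hfreg 1
    rw [hb, add_comm, fadd, Subgroup.coe_mul, Equiv.Perm.mul_apply, hb, ← hc]
    simp [hb]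
  · intro g k
    have h1 : (Equiv.mulLeft (g * k) : Equiv.Perm G) = Equiv.mulLeft g * Equiv.mulLeft k := by
      ext z; simp [mul_assoc]
    have h2 := hc (g * k) 1
    rw [h1, mul_inv_rev] at h2
    have h3 := hc g (c k * 1)
    rw [← hc k 1] at h3
    have h4 : (f (c (g * k) * 1) : Equiv.Perm G) = f (c g * (c k * 1)) := by
      rw [← h2, ← h3]; simp only [mul_assoc]
    simpa using finj (Subtype.ext h4)
  · intro p hp g
    obtain ⟨k, hk⟩ := fsurj ⟨p, hp⟩
    have hk' : p = (f k : Equiv.Perm G) := by rw [hk]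
    subst hk'
    rw [hbf]
    conv_lhs => rw [← hb g]
    rw [← Equiv.Perm.mul_apply, ← Subgroup.coe_mul, ← fadd, hbf, add_comm]

theorem key_arith (n : ℕ) (hn : 4 ≤ n) (hm : m = 2 ^ (n - 1)) (D : DQ G m)
    (b c : G → ZMod (2 ^ n)) (hbij : Function.Bijective b)
    (hb : ∀ g k, b (g * k) = b g + c g * b k) (hc : ∀ g k, c (g * k) = c g * c k) :
    (∀ i, c (D.E (.inl i)) = 1) ∧ (∀ i, Even (b (D.E (.inl i)))) ∧
      IsUnit (b (D.E (.inr 0))) := by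
  have : NeZero m := ⟨by rw [hm]; positivity⟩
  have hn0 : n ≠ 0 := by omega
  have b1 : b 1 = 0 := by
    obtain ⟨h, hh⟩ := hbij.2 0
    have := hb 1 h
    rw [one_mul, hh] at this
    simpa using this.symm
  have c1 : c 1 = 1 := by
    obtain ⟨h, hh⟩ := hbij.2 1
    have := hb 1 h
    rw [one_mul, hh, b1] at this
    simpa using this.symm
  have cu : ∀ g, IsUnit (c g) := fun g =>
    IsUnit.of_mul_eq_one (c g⁻¹) (by rw [← hc, mul_inv_cancel, c1])
  set r : ZMod m → G := fun i => D.E (.inl i) with hr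
  set x : ZMod m → G := fun i => D.E (.inr i) with hx
  have rr : ∀ i j, r i * r j = r (i + j) := D.rr
  have rx : ∀ i j, r i * x j = x (j - i) := D.rx
  have xr : ∀ i j, x i * r j = x (i + j) := D.xr
  have xx : ∀ i j, x i * x j = r (D.e + j - i) := D.xx
  have r0 : r 0 = 1 := D.one
  have rinj : ∀ i j, r i = r j → i = j := by
    intro i j h
    have := D.E.injective h
    simpa using this
  set a := b (r 1) with ha
  set u := c (r 1) with hu
  set v := c (x 0) with hv
  set d := b (x 0) with hd
  have uu : u * u = 1 := by
    have h1 : c (x 0 * r 1) = c (r (-1) * x 0) := by rw [xr, rx]; simp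
    rw [hc, hc, mul_comm] at h1
    have h2 : u = c (r (-1)) := (cu (x 0)).mul_right_cancel h1
    have h3 : c (r 1 * r (-1)) = 1 := by rw [rr]; simp [r0, c1]
    rw [hc, ← h2] at h3
    exact h3
  have b2 : b (r 2) = a * (1 + u) := by
    have : r 2 = r 1 * r 1 := by rw [rr]; norm_num
    rw [this, hb]; ring
  have c2 : c (r 2) = 1 := by
    have : r 2 = r 1 * r 1 := by rw [rr]; norm_num
    rw [this, hc, uu]
  have b2j : ∀ j : ℕ, b (r (2 * j)) = j * (a * (1 + u)) := by
    intro j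
    induction j with
    | zero => simp [r0, b1]
    | succ j ih =>
      have : r (2 * ((j + 1 : ℕ) : ZMod m)) = r 2 * r (2 * j) := by
        rw [rr]; push_cast; congr 1; ring
      rw [this, hb, ih, c2, b2]; push_cast; ring
  obtain ⟨t, ht⟩ := zm_unit_sub_one n hn0 u (cu _)
  have hut : u = 1 + 2 * t := by linear_combination ht
  have h4 : (4 : ZMod m) ≠ 0 := by
    subst hm
    have := zm_pow_ne (n - 1) 2 (by omega)
    intro h; apply this; rw [← h]; norm_num
  have hodd : Even t := by
    rcases zm_even_or_unit n t with h | h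
    · exact h
    · exfalso
      have h1 : t * (2 * (1 + u)) = 0 := by
        linear_combination uu - (1 + u) * hut
      have h2 : 2 * (1 + u) = 0 := h.mul_left_cancel (by rw [h1, mul_zero])
      have h3 := b2j 2
      have h5 : b (r 4) = b 1 := by
        have : (2 : ZMod m) * ((2 : ℕ) : ZMod m) = 4 := by norm_num
        rw [this] at h3
        rw [h3, b1]; push_cast; linear_combination a * h2
      have h6 := hbij.1 h5
      rw [← r0] at h6
      exact h4 (rinj _ _ h6)
  have hnt : IsUnit (1 + t) := by
    rcases zm_even_or_unit n (1 + t) with h | h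
    · exfalso
      have : Even ((1 + t) - t) := h.sub hodd
      rw [add_sub_cancel_right] at this
      exact zm_not_even_unit n hn0 1 this isUnit_one
    · exact h
  have hu2 : 2 * (u - 1) = 0 := by
    apply hnt.mul_left_cancel
    rw [mul_zero]
    linear_combination uu - (u - 1) * hut
  have haE : Even a := by
    rcases zm_even_or_unit n a with h | h
    · exact h
    · exfalso
      have h1 := b2j (2 ^ (n - 2))
      have hz : (2 : ZMod m) * ((2 ^ (n - 2) : ℕ) : ZMod m) = 0 := by
        have : (2 : ZMod m) * ((2 ^ (n - 2) : ℕ) : ZMod m) = ((m : ℕ) : ZMod m) := by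
          rw [hm, show n - 1 = (n - 2) + 1 by omega, pow_succ]; push_cast; ring
        rw [this, ZMod.natCast_self]
      rw [hz, r0, b1] at h1
      have h2 : (a * (1 + t)) * (2 : ZMod (2 ^ n)) ^ (n - 1) = 0 := by
        rw [show n - 1 = (n - 2) + 1 by omega, pow_succ]
        push_cast at h1
        linear_combination -h1 - 2 ^ (n - 2) * a * hut
      have h3 := (h.mul hnt).mul_left_cancel (h2.trans (mul_zero _).symm)
      exact zm_pow_ne n (n - 1) (by omega) h3
  have hua : ∀ y, Even y → u * y = y := by
    rintro y ⟨z, rfl⟩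
    linear_combination z * hu2
  have hbr' : ∀ j : ℕ, Even (b (r j)) ∧ b (r j) = j * a := by
    intro j
    induction j with
    | zero => simp [r0, b1]
    | succ j ih =>
      have : r ((j + 1 : ℕ) : ZMod m) = r 1 * r j := by
        rw [rr]; push_cast; congr 1; ring
      rw [this, hb, hua _ ih.1]
      refine ⟨haE.add ih.1, ?_⟩
      rw [ih.2]; push_cast; ring
  have hbr : ∀ i, Even (b (r i)) := by
    intro i
    have := (hbr' i.val).1
    rwa [ZMod.natCast_zmod_val] at this
  have hdu : IsUnit d := by
    rcases zm_even_or_unit n d with h | h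
    · exfalso
      obtain ⟨g, hg⟩ := hbij.2 1
      apply zm_not_even_unit n hn0 1 _ isUnit_one
      rw [← hg]
      obtain ⟨y, rfl⟩ := D.E.surjective g
      rcases y with k | k
      · exact hbr k
      · change Even (b (x k))
        have : x k = r (-k) * x 0 := by rw [rx]; simp
        rw [this, hb]
        exact (hbr _).add (h.mul_left _)
    · exact h
  have hbneg : b (r (-1)) = -a := by
    have h := hb (r 1) (r (-1))
    rw [rr, add_neg_cancel, r0, b1, ← hu, hua _ (hbr _)] at h
    linear_combination -h
  have hcneg : c (r (-1)) = u := by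
    have h3 : c (r 1 * r (-1)) = 1 := by rw [rr]; simp [r0, c1]
    rw [hc] at h3
    apply (cu (r 1)).mul_left_cancel
    rw [h3]; exact uu.symm
  have hrel : a * (1 + v) = (u - 1) * d := by
    have h1 : b (x 0 * r 1) = b (r (-1) * x 0) := by rw [xr, rx]; simp
    rw [hb, hb, hbneg, hcneg] at h1
    linear_combination h1
  have hv2 : 2 * (1 + v) = 0 := by
    have h1 : b (x 0 * x 0) = b (r D.e) := by rw [xx]; simp
    rw [hb] at h1
    have h2 : b (r D.e) + b (r D.e) = 0 := by
      have hce : c (r D.e) * b (r D.e) = b (r D.e) := by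
        obtain ⟨z, hz⟩ := hbr D.e
        obtain ⟨q, hq⟩ := zm_unit_sub_one n hn0 _ (cu (r D.e))
        -- the multiplier is a power of u
        have hcu : ∀ j : ℕ, ∀ y, Even y → c (r j) * y = y := by
          intro j
          induction j with
          | zero => intro y _; simp [r0, c1]
          | succ j ih =>
            intro y hy
            have : r ((j + 1 : ℕ) : ZMod m) = r 1 * r j := by
              rw [rr]; push_cast; congr 1; ring
            rw [this, hc, mul_assoc, ih y hy]
            exact hua y hy
        have := hcu D.e.val _ (hbr D.e)
        rwa [ZMod.natCast_zmod_val] at this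
      have h := hb (r D.e) (r D.e)
      rw [hce, rr, D.he, r0, b1] at h
      exact h.symm
    apply hdu.mul_left_cancel
    rw [mul_zero]
    linear_combination 2 * h1 + h2
  have hu1 : u = 1 := by
    obtain ⟨z, hz⟩ := haE
    have h1 : d * (u - 1) = 0 := by
      linear_combination -hrel + (1 + v) * hz + z * hv2
    have := hdu.mul_left_cancel (h1.trans (mul_zero _).symm)
    exact sub_eq_zero.mp this
  refine ⟨?_, hbr, hdu⟩
  have hcr : ∀ j : ℕ, c (r j) = 1 := by
    intro j
    induction j with
    | zero => simp [r0, c1]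
    | succ j ih =>
      have : r ((j + 1 : ℕ) : ZMod m) = r 1 * r j := by
        rw [rr]; push_cast; congr 1; ring
      rw [this, hc, ih, ← hu, hu1, mul_one]
  intro i
  have := hcr i.val
  rwa [ZMod.natCast_zmod_val] at this

theorem good_surj (n : ℕ) (hn : 4 ≤ n) (hm : m = 2 ^ (n - 1)) (D : DQ G m)
    (M : Subgroup (Equiv.Perm G)) (h : Good (2 ^ n) M) :
    ∃ w : (ZMod m)ˣ, Subgroup.zpowers (sigP D (w : ZMod m)) = M := by
  have : NeZero m := ⟨by rw [hm]; positivity⟩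
  have hn0 : n ≠ 0 := by omega
  obtain ⟨b, c, hbij, hb, hc, hM⟩ := good_data h
  obtain ⟨hc1, hev, hdu⟩ := key_arith n hn hm D b c hbij hb hc
  have hreg := h.1
  obtain ⟨⟨σ, hσ⟩, hσ1, _⟩ := hreg 1 (D.E (.inr 0))
  change σ 1 = _ at hσ1
  have hσb : ∀ g, b (σ g) = b g + b (D.E (.inr 0)) := by
    intro g; rw [hM σ hσ, hσ1]
  have hbx : ∀ k, b (D.E (.inr k)) = b (D.E (.inl (-k))) + b (D.E (.inr 0)) := by
    intro k
    have h1 : D.E (.inr k) = D.E (.inl (-k)) * D.E (.inr 0) := by rw [D.rx]; simp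
    rw [h1, hb, hc1, one_mul]
  have hbrr : ∀ i j, b (D.E (.inl (i + j))) = b (D.E (.inl i)) + b (D.E (.inl j)) := by
    intro i j
    rw [← D.rr, hb, hc1, one_mul]
  obtain ⟨w, hw⟩ : ∃ w, b (D.E (.inl w)) = b (D.E (.inr 0)) + b (D.E (.inr 0)) := by
    obtain ⟨g, hg⟩ := hbij.2 (b (D.E (.inr 0)) + b (D.E (.inr 0)))
    obtain ⟨y, rfl⟩ := D.E.surjective g
    rcases y with k | k
    · exact ⟨k, hg⟩
    · exfalso
      rw [hbx] at hg
      have := hev (-k)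
      rw [add_right_cancel hg] at this
      exact zm_not_even_unit n hn0 _ this hdu
  have hσw : σ = sigP D w := by
    ext g
    apply hbij.1
    obtain ⟨y, rfl⟩ := D.E.surjective g
    rcases y with k | k
    · rw [hσb, sigP_r, hbx (-k), neg_neg]
    · rw [hσb, sigP_x, hbx k, sub_eq_add_neg, hbrr, hw]; ring
  have hwu : IsUnit w := by
    have hdich : Even w ∨ IsUnit w := by
      subst hm; exact zm_even_or_unit _ w
    rcases hdich with ⟨j, hj⟩ | hw'
    · exfalso
      rw [hj, hbrr] at hw
      set p := b (D.E (.inl j)) with hp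
      set d := b (D.E (.inr 0)) with hd
      have hpd : IsUnit (p - d) := by
        rcases zm_even_or_unit n (p - d) with h' | h'
        · exfalso
          have h2 : Even (p - (p - d)) := (hev j).sub h'
          rw [sub_sub_cancel] at h2
          exact zm_not_even_unit n hn0 _ h2 hdu
        · exact h'
      have h3 : (p - d) * 2 = 0 := by linear_combination hw
      have h4 := hpd.mul_left_cancel (h3.trans (mul_zero _).symm)
      apply zm_pow_ne n 1 (by omega)
      rw [pow_one, h4]
    · exact hw'
  obtain ⟨w', rfl⟩ := hwu
  refine ⟨w', ?_⟩
  have hle : Subgroup.zpowers (sigP D (w' : ZMod m)) ≤ M := by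
    rw [Subgroup.zpowers_le, ← hσw]; exact hσ
  apply le_antisymm hle
  intro π hπ
  obtain ⟨j, hj⟩ := sigP_orbit D w' (π 1)
  have hmem : sigP D (w' : ZMod m) ^ j ∈ Subgroup.zpowers (sigP D (w' : ZMod m)) :=
    Subgroup.pow_mem _ (Subgroup.mem_zpowers _) _
  rw [reg_eq hreg hπ (hle hmem) 1 hj.symm]
  exact hmem

theorem good_card (n : ℕ) (hn : 4 ≤ n) (hm : m = 2 ^ (n - 1)) (D : DQ G m) :
    Nat.card {M : Subgroup (Equiv.Perm G) // Good (2 ^ n) M} = 2 ^ (n - 2) := by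
  have : NeZero m := ⟨by rw [hm]; positivity⟩
  have h2m : 2 * m = 2 ^ n := by
    rw [hm, ← pow_succ']; congr 1; omega
  let F : (ZMod m)ˣ → {M : Subgroup (Equiv.Perm G) // Good (2 ^ n) M} := fun w =>
    ⟨Subgroup.zpowers (sigP D (w : ZMod m)), h2m ▸ zp_good D w⟩
  have hF : Function.Bijective F := by
    constructor
    · intro w w' hww
      have h1 : Subgroup.zpowers (sigP D (w : ZMod m)) = Subgroup.zpowers (sigP D (w' : ZMod m)) :=
        congrArg Subtype.val hww
      have h2 : sigP D (w : ZMod m) = sigP D (w' : ZMod m) := by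
        apply reg_eq (zp_regular D w') (h1 ▸ Subgroup.mem_zpowers _) (Subgroup.mem_zpowers _)
          (D.E (.inl 0))
        rw [sigP_r, sigP_r]
      have h3 := congrArg (fun s : Equiv.Perm G => s (D.E (.inr 0))) h2
      simp only [sigP_x, sub_zero, EmbeddingLike.apply_eq_iff_eq, Sum.inl.injEq] at h3
      exact Units.ext h3
    · rintro ⟨M, hM⟩
      obtain ⟨w, hw⟩ := good_surj n hn hm D M hM
      exact ⟨w, Subtype.ext hw⟩
  rw [← Nat.card_congr (Equiv.ofBijective F hF), Nat.card_eq_fintype_card,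
    ZMod.card_units_eq_totient, hm, Nat.totient_prime_pow Nat.prime_two (by omega)]
  simp [Nat.sub_sub]

end Generic

/-- dihedral data -/
def dqDihedral (m : ℕ) : DQ (DihedralGroup m) m where
  E :=
    { toFun := Sum.elim DihedralGroup.r DihedralGroup.sr
      invFun := fun g => match g with
        | .r i => .inl i
        | .sr i => .inr i
      left_inv := by rintro (k | k) <;> rfl
      right_inv := by rintro (k | k) <;> rfl }
  e := 0
  he := by simp
  one := rfl
  rr := fun i j => by simp
  rx := fun i j => by simp
  xr := fun i j => by simp
  xx := fun i j => by simp

/-- quaternion data -/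
def dqQuaternion (k : ℕ) : DQ (QuaternionGroup k) (2 * k) where
  E :=
    { toFun := Sum.elim QuaternionGroup.a QuaternionGroup.xa
      invFun := fun g => match g with
        | .a i => .inl i
        | .xa i => .inr i
      left_inv := by rintro (k | k) <;> rfl
      right_inv := by rintro (k | k) <;> rfl }
  e := k
  he := by
    have := ZMod.natCast_self (2 * k)
    push_cast at this
    rw [← this]; ring
  one := rfl
  rr := fun i j => by simp
  rx := fun i j => by simp
  xr := fun i j => by simp
  xx := fun i j => by simp

/-- Corollary 5.3: a Galois extension of degree `2 ^ n` (`n ≥ 4`) with quaternion or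
dihedral Galois group admits exactly `2 ^ (n - 2)` Hopf–Galois structures of cyclic
type, via the Greither–Pareigis correspondence. -/
theorem card_cyclic_HGS_on_quaternion_or_dihedral (n : ℕ) (hn : 4 ≤ n) :
    Nat.card {M : Subgroup (Equiv.Perm (QuaternionGroup (2 ^ (n - 2)))) //
      IsRegularPermSubgroup M ∧ IsNormalizedByLeftTranslations M ∧
      Nonempty (M ≃* Multiplicative (ZMod (2 ^ n)))} = 2 ^ (n - 2) ∧
    Nat.card {M : Subgroup (Equiv.Perm (DihedralGroup (2 ^ (n - 1)))) //
      IsRegularPermSubgroup M ∧ IsNormalizedByLeftTranslations M ∧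
      Nonempty (M ≃* Multiplicative (ZMod (2 ^ n)))} = 2 ^ (n - 2) := by
  exact ⟨good_card n hn (by rw [← pow_succ']; congr 1; omega) (dqQuaternion (2 ^ (n - 2))),
    good_card n hn rfl (dqDihedral (2 ^ (n - 1)))⟩
end

section
/- Let n ≥ 5 be an integer and let G be the generalised quaternion group Q_{2^n} (QuaternionGroup 2^{n-2}) or the dihedral group D_{2^n} (DihedralGroup 2^{n-1}). Then the number of subgroups M of Perm(G) such that M acts regularly on G, M is normalized by the image of the left-translation embedding λ : G → Perm(G), and M is isomorphic to Z/2Z × Z/2^{n-1}Z, equals 2^{n+1}. (Equivalently: any Galois extension of degree 2^n with quaternion or dihedral Galois group admits exactly 2^{n+1} Hopf–Galois structures of type C_2 × C_{2^{n-1}}.) -/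
namespace HGSCount

/-- A permutation of an additive group is affine if its translate fixing zero is additive. -/
def IsAffinePerm {N : Type} [AddCommGroup N] (f : Equiv.Perm N) : Prop :=
  ∀ s t, f (s + t) = f s + f t - f 0

/-- Regular affine embeddings of `G` into permutations of `N`. -/
def RegEmb (G N : Type) [Group G] [AddCommGroup N] : Type :=
  {φ : G →* Equiv.Perm N // (∀ g, IsAffinePerm (φ g)) ∧ Function.Bijective (fun g => φ g 0)}

/-- Regular embeddings of `N` into permutations of `G`, with image normalized by translations. -/
def RegHom (G N : Type) [Group G] [AddCommGroup N] : Type :=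
  {θ : Multiplicative N →* Equiv.Perm G //
    Function.Bijective (fun t : N => θ (Multiplicative.ofAdd t) 1) ∧
    ∀ g t, ∃ t', Equiv.mulLeft g * θ t * (Equiv.mulLeft g)⁻¹ = θ t'}

section general

variable {G N : Type} [Group G] [AddCommGroup N]

/-- The points bijection of a regular hom. -/
noncomputable def RegHom.pt (θ : RegHom G N) : N ≃ G := Equiv.ofBijective _ θ.2.1

theorem RegHom.pt_apply (θ : RegHom G N) (t : N) :
    θ.pt t = θ.1 (Multiplicative.ofAdd t) 1 := rfl

theorem RegHom.pt_add (θ : RegHom G N) (s t : N) :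
    θ.pt (s + t) = θ.1 (Multiplicative.ofAdd s) (θ.pt t) := by
  simp [RegHom.pt_apply, ofAdd_add]

theorem RegHom.pt_zero (θ : RegHom G N) : θ.pt 0 = 1 := by
  simp [RegHom.pt_apply]

/-- The points bijection of a regular embedding. -/
noncomputable def RegEmb.pt (φ : RegEmb G N) : G ≃ N := Equiv.ofBijective _ φ.2.2

theorem RegEmb.pt_apply (φ : RegEmb G N) (g : G) : φ.pt g = φ.1 g 0 := rfl

theorem RegEmb.pt_mul (φ : RegEmb G N) (g h : G) : φ.pt (g * h) = φ.1 g (φ.pt h) := by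
  simp [RegEmb.pt_apply]

theorem RegEmb.pt_one (φ : RegEmb G N) : φ.pt 1 = 0 := by
  simp [RegEmb.pt_apply]

/-- From a regular hom to a regular embedding. -/
noncomputable def toEmb (θ : RegHom G N) : RegEmb G N := by
  refine ⟨{ toFun := fun g => (θ.pt.trans (Equiv.mulLeft g)).trans θ.pt.symm
            map_one' := by ext; simp
            map_mul' := by intro g h; ext t; simp }, ?_, ?_⟩
  · intro g
    have key : ∀ t, ∃ t' : N, ∀ s,
        θ.pt.symm (g * θ.pt (t + s)) = t' + θ.pt.symm (g * θ.pt s) := by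
      intro t
      obtain ⟨t', ht'⟩ := θ.2.2 g (Multiplicative.ofAdd t)
      refine ⟨t'.toAdd, fun s => ?_⟩
      rw [Equiv.symm_apply_eq, RegHom.pt_add, RegHom.pt_add]
      have := congrArg (fun e : Equiv.Perm G => e (g * θ.pt s)) ht'
      simpa using this
    intro s t
    obtain ⟨t', ht'⟩ := key s
    have h0 := ht' 0
    have h1 := ht' t
    simp only [add_zero] at h0
    simp only [MonoidHom.coe_mk, OneHom.coe_mk, Equiv.trans_apply, Equiv.coe_mulLeft]
    rw [h1, h0]
    abel
  · have : (fun g : G => θ.pt.symm (g * θ.pt 0)) = θ.pt.symm := by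
      ext g; simp [RegHom.pt_zero]
    simpa [this] using θ.pt.symm.bijective

/-- From a regular embedding to a regular hom. -/
noncomputable def toHom (φ : RegEmb G N) : RegHom G N := by
  refine ⟨{ toFun := fun t => (φ.pt.trans (Equiv.addLeft t.toAdd)).trans φ.pt.symm
            map_one' := by ext; simp
            map_mul' := by intro g h; ext t; simp }, ?_, ?_⟩
  · have : (fun t : N => φ.pt.symm (t + φ.pt 1)) = φ.pt.symm := by
      ext g; simp [RegEmb.pt_one]
    simpa [this] using φ.pt.symm.bijective
  · intro g t
    refine ⟨Multiplicative.ofAdd (φ.1 g t.toAdd - φ.1 g 0), ?_⟩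
    ext h
    apply φ.pt.injective
    simp only [MonoidHom.coe_mk, OneHom.coe_mk, Equiv.Perm.coe_mul, Function.comp_apply,
      Equiv.mulLeft_symm, Equiv.Perm.inv_def, Equiv.trans_apply, Equiv.coe_mulLeft,
      Equiv.coe_addLeft, Equiv.apply_symm_apply, RegEmb.pt_mul, toAdd_ofAdd]
    rw [φ.2.1 g]
    have : φ.1 g (φ.1 g⁻¹ (φ.pt h)) = φ.pt h := by
      rw [← Equiv.Perm.mul_apply, ← map_mul]; simp
    rw [this]; abel

theorem pt_toHom (φ : RegEmb G N) : (toHom φ).pt = φ.pt.symm := by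
  ext t
  rw [RegHom.pt_apply]
  simp [toHom, RegEmb.pt_one]

theorem pt_toEmb (θ : RegHom G N) : (toEmb θ).pt = θ.pt.symm := by
  ext t
  rw [RegEmb.pt_apply]
  simp [toEmb, RegHom.pt_zero]

/-- The two descriptions agree. -/
noncomputable def homEquivEmb : RegHom G N ≃ RegEmb G N where
  toFun := toEmb
  invFun := toHom
  left_inv θ := by
    apply Subtype.ext
    refine MonoidHom.ext fun t => Equiv.ext fun g => ?_
    change (toEmb θ).pt.symm (t.toAdd + (toEmb θ).pt g) = _
    rw [pt_toEmb]
    rw [Equiv.symm_symm, RegHom.pt_add]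
    simp
  right_inv φ := by
    apply Subtype.ext
    refine MonoidHom.ext fun g => Equiv.ext fun t => ?_
    change (toHom φ).pt.symm (g * (toHom φ).pt t) = _
    rw [pt_toHom]
    rw [Equiv.symm_symm, RegEmb.pt_mul]
    simp

/-- The subgroups to be counted. -/
abbrev HGS (G N : Type) [Group G] [AddCommGroup N] : Type :=
  {M : Subgroup (Equiv.Perm G) // IsRegularPermSubgroup M ∧ IsNormalizedByLeftTranslations M ∧
      Nonempty (M ≃* Multiplicative N)}

/-- A chosen isomorphism. -/
noncomputable def HGS.iso (M : HGS G N) : Multiplicative N ≃* M.1 := M.2.2.2.some.symm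

/-- A subgroup and an automorphism give a regular hom. -/
noncomputable def mkHom (p : HGS G N × MulAut (Multiplicative N)) : RegHom G N := by
  refine ⟨(p.1.1.subtype.comp p.1.iso.toMonoidHom).comp p.2.toMonoidHom, ?_, ?_⟩
  · constructor
    · intro s t h
      have := (p.1.2.1 1 ((p.1.iso (p.2 (Multiplicative.ofAdd t)) : Equiv.Perm G) 1)).unique
        (y₁ := p.1.iso (p.2 (Multiplicative.ofAdd s)))
        (y₂ := p.1.iso (p.2 (Multiplicative.ofAdd t))) h rfl
      simpa using this
    · intro g
      obtain ⟨π, hπ, hu⟩ := p.1.2.1 1 g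
      refine ⟨(p.2.symm (p.1.iso.symm π)).toAdd, ?_⟩
      simpa using hπ
  · intro g t
    have := p.1.2.2.1 g _ (p.1.iso (p.2 t)).2
    refine ⟨p.2.symm (p.1.iso.symm ⟨_, this⟩), ?_⟩
    simp

theorem mkHom_range (p : HGS G N × MulAut (Multiplicative N)) :
    (mkHom p).1.range = p.1.1 := by
  ext π
  constructor
  · rintro ⟨t, rfl⟩
    exact (p.1.iso (p.2 t)).2
  · intro h
    refine ⟨p.2.symm (p.1.iso.symm ⟨π, h⟩), ?_⟩
    simp [mkHom]

theorem mkHom_injective : Function.Injective (mkHom (G := G) (N := N)) := by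
  rintro ⟨M, α⟩ ⟨M', α'⟩ h
  have hM : M = M' := by
    apply Subtype.ext
    rw [← mkHom_range (M, α), h, mkHom_range (M', α')]
  subst hM
  congr 1
  ext1 t
  have := congrArg (fun θ : RegHom G N => θ.1 t) h
  have h2 : (M.iso (α t) : Equiv.Perm G) = M.iso (α' t) := this
  exact M.iso.injective (Subtype.ext h2)

theorem RegHom.injective (θ : RegHom G N) : Function.Injective θ.1 := by
  intro s t h
  have := @θ.2.1.1 s.toAdd t.toAdd (by simp [h])
  simpa using this

/-- The subgroup of a regular hom. -/
noncomputable def RegHom.hgs (θ : RegHom G N) : HGS G N := by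
  refine ⟨θ.1.range, ?_, ?_, ⟨(MonoidHom.ofInjective θ.injective).symm⟩⟩
  · intro x y
    obtain ⟨s, rfl⟩ := θ.pt.surjective x
    obtain ⟨t, rfl⟩ := θ.pt.surjective y
    refine ⟨⟨θ.1 (Multiplicative.ofAdd (t - s)), _, rfl⟩, ?_, ?_⟩
    · change θ.1 _ _ = _
      rw [← RegHom.pt_add]; simp
    · rintro ⟨_, w, rfl⟩ h
      apply Subtype.ext
      change θ.1 w (θ.pt s) = θ.pt t at h
      have h2 := RegHom.pt_add θ w.toAdd s
      rw [ofAdd_toAdd, h] at h2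
      have := θ.pt.injective h2
      rw [← this]; simp
  · rintro g _ ⟨t, rfl⟩
    obtain ⟨t', h⟩ := θ.2.2 g t
    exact ⟨t', h.symm⟩

theorem mkHom_surjective : Function.Surjective (mkHom (G := G) (N := N)) := by
  intro θ
  refine ⟨(θ.hgs, (MonoidHom.ofInjective θ.injective).trans θ.hgs.iso.symm), ?_⟩
  apply Subtype.ext
  refine MonoidHom.ext fun t => ?_
  exact congrArg Subtype.val (MulEquiv.apply_symm_apply θ.hgs.iso
    (MonoidHom.ofInjective θ.injective t))

theorem card_HGS_mul : Nat.card (HGS G N) * Nat.card (AddAut N) = Nat.card (RegEmb G N) := by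
  rw [← Nat.card_congr homEquivEmb,
    ← Nat.card_congr (Equiv.ofBijective _ ⟨mkHom_injective (G := G) (N := N), mkHom_surjective⟩),
    Nat.card_prod]
  congr 1
  exact Nat.card_congr (AddEquiv.toMultiplicative (G := N) (H := N))

end general
end HGSCount

namespace HGSCount

/-- The type `C₂ × C_{4q}` with `q = 2 ^ s`. -/
abbrev NN (s : ℕ) : Type := ZMod 2 × ZMod (2 ^ (s + 2))

/-- The point of `NN s` with given integer coordinates. -/
def mkN (s : ℕ) (a b : ℤ) : NN s := ((a : ZMod 2), (b : ZMod (2 ^ (s + 2))))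

theorem modulus_cast (s : ℕ) : (((2 ^ (s + 2) : ℕ)) : ℤ) = 4 * 2 ^ s := by
  push_cast; ring

theorem mkN_eq {s : ℕ} {a b a' b' : ℤ} :
    mkN s a b = mkN s a' b' ↔ (2 : ℤ) ∣ a' - a ∧ (4 * 2 ^ s : ℤ) ∣ b' - b := by
  unfold mkN
  rw [Prod.mk.injEq, ZMod.intCast_eq_intCast_iff_dvd_sub, ZMod.intCast_eq_intCast_iff_dvd_sub,
    modulus_cast]
  norm_num

theorem exists_mkN {s : ℕ} (p : NN s) : ∃ a b : ℤ, p = mkN s a b := by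
  obtain ⟨a, b⟩ := p
  obtain ⟨a, rfl⟩ := ZMod.intCast_surjective a
  obtain ⟨b, rfl⟩ := ZMod.intCast_surjective b
  exact ⟨a, b, rfl⟩

theorem mkN_add (s : ℕ) (a b a' b' : ℤ) :
    mkN s a b + mkN s a' b' = mkN s (a + a') (b + b') := by
  simp [mkN]

theorem mkN_sub (s : ℕ) (a b a' b' : ℤ) :
    mkN s a b - mkN s a' b' = mkN s (a - a') (b - b') := by
  simp [mkN]

theorem mkN_zero (s : ℕ) : mkN s 0 0 = 0 := by
  simp [mkN]

theorem mkN_zsmul (s : ℕ) (k a b : ℤ) : k • mkN s a b = mkN s (k * a) (k * b) := by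
  simp [mkN]

/-- The affine map with given integer parameters. -/
def aff (s : ℕ) (c d e u v : ℤ) (p : NN s) : NN s :=
  mkN s ((p.1.cast : ℤ) + c * (p.2.cast : ℤ) + u)
    (2 * 2 ^ s * d * (p.1.cast : ℤ) + e * (p.2.cast : ℤ) + v)

theorem aff_mkN (s : ℕ) (c d e u v a b : ℤ) :
    aff s c d e u v (mkN s a b) = mkN s (a + c * b + u) (2 * 2 ^ s * d * a + e * b + v) := by
  unfold aff
  have h1 : (2 : ℤ) ∣ a - ((mkN s a b).1.cast : ℤ) := by
    have := (ZMod.intCast_eq_intCast_iff_dvd_sub ((mkN s a b).1.cast : ℤ) a 2).1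
      (by rw [ZMod.intCast_zmod_cast]; rfl)
    simpa using this
  have h2 : (4 * 2 ^ s : ℤ) ∣ b - ((mkN s a b).2.cast : ℤ) := by
    have := (ZMod.intCast_eq_intCast_iff_dvd_sub ((mkN s a b).2.cast : ℤ) b (2 ^ (s + 2))).1
      (by rw [ZMod.intCast_zmod_cast]; rfl)
    rwa [modulus_cast] at this
  generalize ((mkN s a b).1.cast : ℤ) = a' at *
  generalize ((mkN s a b).2.cast : ℤ) = b' at *
  obtain ⟨w, hw⟩ := h1
  obtain ⟨z, hz⟩ := h2
  rw [mkN_eq]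
  constructor
  · exact ⟨w + c * (2 * 2 ^ s * z), by linear_combination hw + c * hz⟩
  · exact ⟨d * w + e * z, by linear_combination 2 * 2 ^ s * d * hw + e * hz⟩

theorem aff_comp (s : ℕ) (c d e u v c' d' e' u' v' : ℤ) (p : NN s) :
    aff s c' d' e' u' v' (aff s c d e u v p) =
      aff s (c + c' * e) (d' + e' * d) (e' * e + 2 * 2 ^ s * d' * c) (u + u' + c' * v)
        (2 * 2 ^ s * d' * u + e' * v + v') p := by
  obtain ⟨a, b, rfl⟩ := exists_mkN p
  rw [aff_mkN, aff_mkN, aff_mkN, mkN_eq]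
  constructor
  · exact ⟨-c' * (2 ^ s * d * a), by ring⟩
  · exact ⟨0, by ring⟩

theorem aff_eq {s : ℕ} {c d e u v c' d' e' u' v' : ℤ} :
    aff s c d e u v = aff s c' d' e' u' v' ↔ 2 ∣ c' - c ∧ 2 ∣ d' - d ∧
      (4 * 2 ^ s : ℤ) ∣ e' - e ∧ 2 ∣ u' - u ∧ (4 * 2 ^ s : ℤ) ∣ v' - v := by
  constructor
  · intro h
    have h0 := congrFun h (mkN s 0 0)
    have h1 := congrFun h (mkN s 1 0)
    have h2 := congrFun h (mkN s 0 1)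
    rw [aff_mkN, aff_mkN, mkN_eq] at h0 h1 h2
    obtain ⟨⟨x1, h01⟩, ⟨x2, h02⟩⟩ := h0
    obtain ⟨-, ⟨x3, h12⟩⟩ := h1
    obtain ⟨⟨x4, h21⟩, ⟨x5, h22⟩⟩ := h2
    refine ⟨⟨x4 - x1, by linear_combination h21 - h01⟩, ?_,
      ⟨x5 - x2, by linear_combination h22 - h02⟩, ⟨x1, by linear_combination h01⟩,
      ⟨x2, by linear_combination h02⟩⟩
    have h3 : (2 * 2 ^ s) * 2 ∣ (2 * 2 ^ s) * (d' - d) :=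
      ⟨x3 - x2, by linear_combination h12 - h02⟩
    exact Int.dvd_of_mul_dvd_mul_left (by positivity) h3
  · rintro ⟨⟨x1, h1⟩, ⟨x2, h2⟩, ⟨x3, h3⟩, ⟨x4, h4⟩, ⟨x5, h5⟩⟩
    funext p
    obtain ⟨a, b, rfl⟩ := exists_mkN p
    rw [aff_mkN, aff_mkN, mkN_eq]
    constructor
    · exact ⟨x1 * b + x4, by linear_combination b * h1 + h4⟩
    · exact ⟨x2 * a + x3 * b + x5, by linear_combination 2 * 2 ^ s * a * h2 + b * h3 + h5⟩

theorem aff_zero_apply (s : ℕ) (c d e u v : ℤ) : aff s c d e u v 0 = mkN s u v := by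
  rw [← mkN_zero, aff_mkN]; simp

theorem aff_add (s : ℕ) (c d e u v : ℤ) (p p' : NN s) :
    aff s c d e u v (p + p') = aff s c d e u v p + aff s c d e u v p' - aff s c d e u v 0 := by
  obtain ⟨a, b, rfl⟩ := exists_mkN p
  obtain ⟨a', b', rfl⟩ := exists_mkN p'
  rw [aff_zero_apply, mkN_add, aff_mkN, aff_mkN, aff_mkN, mkN_add, mkN_sub]
  congr 1 <;> ring

theorem two_dvd_of_odd_mul {e b : ℤ} (he : e % 2 = 1) (h : 2 ∣ e * b) : 2 ∣ b := by
  rcases Int.prime_two.dvd_or_dvd h with h | h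
  · omega
  · exact h

theorem pow_dvd_of_odd_mul {t : ℕ} {e b : ℤ} (he : e % 2 = 1) (h : (2 : ℤ) ^ t ∣ e * b) :
    (2 : ℤ) ^ t ∣ b := by
  refine IsCoprime.dvd_of_dvd_mul_left ?_ h
  apply IsCoprime.pow_left
  exact ⟨-(e / 2), 1, by omega⟩

theorem four_pow (s : ℕ) : (4 * 2 ^ s : ℤ) = 2 ^ (s + 2) := by ring

theorem aff_injective {s : ℕ} {c d e u v : ℤ} (he : e % 2 = 1) :
    Function.Injective (aff s c d e u v) := by
  intro p p' h
  obtain ⟨a, b, rfl⟩ := exists_mkN p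
  obtain ⟨a', b', rfl⟩ := exists_mkN p'
  rw [aff_mkN, aff_mkN, mkN_eq] at h
  rw [mkN_eq]
  obtain ⟨⟨x, hx⟩, ⟨y, hy⟩⟩ := h
  have h1 : (2 : ℤ) ∣ b' - b := by
    apply two_dvd_of_odd_mul he
    exact ⟨2 * 2 ^ s * y - 2 ^ s * d * (a' - a), by linear_combination hy⟩
  obtain ⟨z, hz⟩ := h1
  have h2 : a' - a = 2 * (x - c * z) := by linear_combination hx - c * hz
  refine ⟨⟨_, h2⟩, ?_⟩
  rw [four_pow]
  apply pow_dvd_of_odd_mul he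
  rw [← four_pow]
  exact ⟨y - d * (x - c * z), by linear_combination hy - 2 * 2 ^ s * d * h2⟩

theorem exists_perm (s : ℕ) (c d e u v : ℤ) (he : e % 2 = 1) :
    ∃ X : Equiv.Perm (NN s), ⇑X = aff s c d e u v :=
  ⟨Equiv.ofBijective _ (Finite.injective_iff_bijective.1 (aff_injective he)), rfl⟩

theorem isAffine_of_eq {s : ℕ} {c d e u v : ℤ} {X : Equiv.Perm (NN s)}
    (h : ⇑X = aff s c d e u v) : IsAffinePerm X := by
  intro p p'
  rw [h]
  exact aff_add _ _ _ _ _ _ _ _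

theorem eq_aff_of_isAffine {s : ℕ} {X : Equiv.Perm (NN s)} (h : IsAffinePerm X) :
    ∃ c d e u v : ℤ, e % 2 = 1 ∧ ⇑X = aff s c d e u v := by
  let f : NN s →+ NN s := AddMonoidHom.mk' (fun p => X p - X 0) (by
    intro p p'; simp only [h p p']; abel)
  have hf : ∀ p, f p = X p - X 0 := fun _ => rfl
  have finj : ∀ p, f p = 0 → p = 0 := by
    intro p hp
    rw [hf, sub_eq_zero] at hp
    exact X.injective hp
  obtain ⟨u, v, huv⟩ := exists_mkN (X 0)
  obtain ⟨a, d0, h1⟩ := exists_mkN (f (mkN s 1 0))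
  obtain ⟨c, e, h2⟩ := exists_mkN (f (mkN s 0 1))
  have hlin : ∀ x y : ℤ, f (mkN s x y) = mkN s (x * a + y * c) (x * d0 + y * e) := by
    intro x y
    have : mkN s x y = x • mkN s 1 0 + y • mkN s 0 1 := by
      rw [mkN_zsmul, mkN_zsmul, mkN_add]; simp
    rw [this, map_add, map_zsmul, map_zsmul, h1, h2, mkN_zsmul, mkN_zsmul, mkN_add]
  have hq : (2 : ℤ) ^ s ≠ 0 := by positivity
  -- the image of the involution
  have hd : (4 * 2 ^ s : ℤ) ∣ 2 * d0 := by
    have : mkN s 2 0 = mkN s 0 0 := mkN_eq.2 ⟨⟨-1, by norm_num⟩, ⟨0, by norm_num⟩⟩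
    have h3 := hlin 2 0
    rw [this, mkN_zero, map_zero, ← mkN_zero, mkN_eq] at h3
    simpa using h3.2
  obtain ⟨d, hd⟩ := hd
  have hd : d0 = 2 * 2 ^ s * d := by linarith
  have he : e % 2 = 1 := by
    by_contra hne
    have h2e : (2 : ℤ) ∣ e := by omega
    obtain ⟨e', he'⟩ := h2e
    have h3 := hlin 0 (2 * 2 ^ s)
    have h4 : mkN s (0 * a + 2 * 2 ^ s * c) (0 * d0 + 2 * 2 ^ s * e) = mkN s 0 0 :=
      mkN_eq.2 ⟨⟨-(2 ^ s * c), by ring⟩, ⟨-e', by rw [he']; ring⟩⟩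
    rw [h4, mkN_zero] at h3
    have h5 := finj _ h3
    rw [← mkN_zero, mkN_eq] at h5
    obtain ⟨w, hw⟩ := h5.2
    have : (2 : ℤ) ^ s * (2 * w + 1) = 0 := by linarith
    rcases mul_eq_zero.1 this with h | h
    · exact hq h
    · omega
  have ha : a % 2 = 1 := by
    by_contra hne
    have h2a : (2 : ℤ) ∣ a := by omega
    obtain ⟨a', ha'⟩ := h2a
    have h3 := hlin 1 (2 * 2 ^ s * d)
    have h2e : (2 : ℤ) ∣ e + 1 := by omega
    obtain ⟨e', he'⟩ := h2e
    have h4 : mkN s (1 * a + 2 * 2 ^ s * d * c) (1 * d0 + 2 * 2 ^ s * d * e) = mkN s 0 0 :=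
      mkN_eq.2 ⟨⟨-(a' + 2 ^ s * d * c), by rw [ha']; ring⟩,
        ⟨-(d * e'), by rw [hd]; linear_combination -2 * 2 ^ s * d * he'⟩⟩
    rw [h4, mkN_zero] at h3
    have h5 := finj _ h3
    rw [← mkN_zero, mkN_eq] at h5
    have := h5.1
    omega
  refine ⟨c, d, e, u, v, he, ?_⟩
  funext p
  obtain ⟨x, y, rfl⟩ := exists_mkN p
  have h3 := hlin x y
  rw [hf, sub_eq_iff_eq_add, huv, mkN_add] at h3
  rw [h3, aff_mkN, mkN_eq]
  constructor
  · have : (2 : ℤ) ∣ 1 - a := by omega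
    obtain ⟨w, hw⟩ := this
    exact ⟨x * w, by linear_combination x * hw⟩
  · exact ⟨0, by rw [hd]; ring⟩

/-! ### Automorphisms -/

theorem fin_eq_of_dvd {t : ℕ} {i j : Fin t} (h : (t : ℤ) ∣ (j : ℤ) - (i : ℤ)) : i = j := by
  have h1 := i.2
  have h2 := j.2
  have h3 : ((j : ℤ) - (i : ℤ)) = 0 := by
    apply Int.eq_zero_of_abs_lt_dvd h
    rw [abs_lt]; omega
  apply Fin.ext
  omega

theorem exists_fin (t : ℕ) (ht : 0 < t) (z : ℤ) : ∃ i : Fin t, (t : ℤ) ∣ (i : ℤ) - z := by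
  refine ⟨⟨(z % t).toNat, ?_⟩, ?_⟩
  · have := Int.emod_lt_of_pos z (by exact_mod_cast ht : (0 : ℤ) < t)
    have := Int.emod_nonneg z (by exact_mod_cast ht.ne' : (t : ℤ) ≠ 0)
    omega
  · have := Int.emod_nonneg z (by exact_mod_cast ht.ne' : (t : ℤ) ≠ 0)
    simp only [Int.toNat_of_nonneg this]
    exact ⟨-(z / t), by have := Int.emod_add_mul_ediv z t; linarith⟩

theorem card_addAut (s : ℕ) : Nat.card (AddAut (NN s)) = 8 * 2 ^ s := by
  have hex : ∀ p : Fin 2 × Fin 2 × Fin (2 * 2 ^ s), ∃ α : AddAut (NN s),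
      ⇑α = aff s (p.1 : ℤ) (p.2.1 : ℤ) (1 + 2 * (p.2.2 : ℤ)) 0 0 := by
    intro p
    obtain ⟨X, hX⟩ := exists_perm s (p.1 : ℤ) (p.2.1 : ℤ) (1 + 2 * (p.2.2 : ℤ)) 0 0 (by omega)
    refine ⟨⟨X, ?_⟩, hX⟩
    intro a b
    change X (a + b) = X a + X b
    rw [hX, aff_add, aff_zero_apply, mkN_zero, sub_zero]
  choose F hF using hex
  have hbij : Function.Bijective F := by
    constructor
    · intro p p' h
      have h1 := hF p
      rw [h, hF p', aff_eq] at h1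
      obtain ⟨h1, h2, h3, -, -⟩ := h1
      have h3 : ((2 * 2 ^ s : ℕ) : ℤ) ∣ (p.2.2 : ℤ) - (p'.2.2 : ℤ) := by
        obtain ⟨w, hw⟩ := h3
        refine ⟨w, ?_⟩
        push_cast
        linarith
      exact (Prod.ext (fin_eq_of_dvd h1) (Prod.ext (fin_eq_of_dvd h2) (fin_eq_of_dvd h3))).symm
    · intro α
      have hα : IsAffinePerm (α : Equiv.Perm (NN s)) := by
        intro a b
        change α (a + b) = α a + α b - α 0
        rw [map_add, map_zero, sub_zero]
      obtain ⟨c, d, e, u, v, he, h⟩ := eq_aff_of_isAffine hα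
      have h0 : mkN s u v = mkN s 0 0 := by
        rw [← aff_zero_apply s c d e, ← h, mkN_zero]; exact map_zero α
      rw [mkN_eq] at h0
      obtain ⟨c', hc⟩ := exists_fin 2 (by norm_num) c
      obtain ⟨d', hd⟩ := exists_fin 2 (by norm_num) d
      obtain ⟨e', he'⟩ := exists_fin (2 * 2 ^ s) (by positivity) (e / 2)
      refine ⟨(c', d', e'), ?_⟩
      apply DFunLike.coe_injective
      rw [hF]
      change _ = ⇑(α : Equiv.Perm (NN s))
      rw [h]
      symm
      rw [aff_eq]
      refine ⟨hc, hd, ?_, h0.1, h0.2⟩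
      obtain ⟨w, hw⟩ := he'
      refine ⟨w, ?_⟩
      have : e = 1 + 2 * (e / 2) := by omega
      push_cast at hw
      linarith
  rw [← Nat.card_congr (Equiv.ofBijective F hbij)]
  simp
  ring

end HGSCount

namespace HGSCount

section relations

variable {s : ℕ}

theorem mul_eq_aff {X Y : Equiv.Perm (NN s)} {c d e u v c' d' e' u' v' : ℤ}
    (hX : ⇑X = aff s c' d' e' u' v') (hY : ⇑Y = aff s c d e u v) :
    ⇑(X * Y) = aff s (c + c' * e) (d' + e' * d) (e' * e + 2 * 2 ^ s * d' * c) (u + u' + c' * v)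
        (2 * 2 ^ s * d' * u + e' * v + v') := by
  funext p
  rw [Equiv.Perm.mul_apply, hX, hY, aff_comp]

theorem pow_two_aff (hs : 2 ≤ s) {X : Equiv.Perm (NN s)} {c d e u v : ℤ} (he : e % 2 = 1)
    (hX : ⇑X = aff s c d e u v) (i : ℕ) : ∃ k j : ℤ, k % 2 = 1 ∧
      ⇑(X ^ (2 ^ (i + 1))) = aff s 0 0 (1 + 8 * 2 ^ i * j) (2 ^ i * (c * v))
        (2 ^ i * (2 * 2 ^ s * d * u + (e + 1) * v) * k) := by
  induction i with
  | zero =>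
    obtain ⟨t, ht⟩ : ∃ t, e = 2 * t + 1 := ⟨e / 2, by omega⟩
    obtain ⟨t', ht'⟩ : ∃ t', t * (t + 1) = 2 * t' := by
      obtain ⟨r, hr⟩ := Int.even_mul_succ_self t
      exact ⟨r, by linarith⟩
    obtain ⟨s', rfl⟩ : ∃ s', s = s' + 2 := ⟨s - 2, by omega⟩
    refine ⟨1, t' + 2 ^ s' * d * c, by norm_num, ?_⟩
    have : X ^ 2 ^ (0 + 1) = X * X := by simp [pow_two]
    rw [this, mul_eq_aff hX hX, aff_eq]
    refine ⟨⟨-(c * (t + 1)), ?_⟩, ⟨-(d * (t + 1)), ?_⟩, ⟨0, ?_⟩, ⟨-u, ?_⟩, ⟨0, ?_⟩⟩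
    · rw [ht]; ring
    · rw [ht]; ring
    · rw [ht]; linear_combination -4 * ht'
    · ring
    · ring
  | succ i ih =>
    obtain ⟨k, j, hk, h⟩ := ih
    refine ⟨k * (1 + 4 * 2 ^ i * j), j + 4 * 2 ^ i * j * j, ?_, ?_⟩
    · have : k * (1 + 4 * 2 ^ i * j) = k + 2 * (2 * (k * 2 ^ i * j)) := by ring
      omega
    · have : X ^ 2 ^ (i + 1 + 1) = X ^ 2 ^ (i + 1) * X ^ 2 ^ (i + 1) := by
        rw [← pow_add]; congr 1; ring
      rw [this, mul_eq_aff h h, aff_eq]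
      refine ⟨⟨0, ?_⟩, ⟨0, ?_⟩, ⟨0, ?_⟩, ⟨0, ?_⟩, ⟨0, ?_⟩⟩ <;> ring

theorem pow_half (hs : 2 ≤ s) {X : Equiv.Perm (NN s)} {c d e u v : ℤ} (he : e % 4 = 1)
    (hv : v % 2 = 1) (hX : ⇑X = aff s c d e u v) :
    ⇑(X ^ (2 ^ (s + 1))) = aff s 0 0 1 0 (2 * 2 ^ s) := by
  obtain ⟨k, j, hk, h⟩ := pow_two_aff hs (by omega) hX s
  rw [h, aff_eq]
  obtain ⟨s', rfl⟩ : ∃ s', s = s' + 2 := ⟨s - 2, by omega⟩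
  obtain ⟨t, ht⟩ : ∃ t, e = 4 * t + 1 := ⟨e / 4, by omega⟩
  obtain ⟨v', hv'⟩ : ∃ t, v = 2 * t + 1 := ⟨v / 2, by omega⟩
  obtain ⟨k', hk'⟩ : ∃ t, k = 2 * t + 1 := ⟨k / 2, by omega⟩
  refine ⟨⟨0, by ring⟩, ⟨0, by ring⟩, ⟨-(2 * j), by ring⟩,
    ⟨-(2 * 2 ^ s' * (c * v)), by ring⟩, ?_⟩
  refine ⟨-(2 * 2 ^ s' * d * u * k + t * (2 * v' + 1) * (2 * k' + 1) + 2 * v' * k' + v' + k'), ?_⟩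
  rw [hk', hv', ht]
  ring

theorem odd_of_half (hs : 2 ≤ s) {X : Equiv.Perm (NN s)} {c d e u v : ℤ} (he : e % 2 = 1)
    (hX : ⇑X = aff s c d e u v) (hne : (X ^ (2 ^ (s + 1))) 0 ≠ 0) : e % 4 = 1 ∧ v % 2 = 1 := by
  by_contra hcon
  apply hne
  obtain ⟨k, j, hk, h⟩ := pow_two_aff hs he hX s
  obtain ⟨s', rfl⟩ : ∃ s', s = s' + 2 := ⟨s - 2, by omega⟩
  have h4 : (4 : ℤ) ∣ (e + 1) * v := by
    by_cases h1 : e % 4 = 1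
    · have h2 : (2 : ℤ) ∣ v := by omega
      have h3 : (2 : ℤ) ∣ e + 1 := by omega
      exact mul_dvd_mul h3 h2
    · exact Dvd.dvd.mul_right (by omega) _
  obtain ⟨w, hw⟩ := h4
  rw [h, aff_zero_apply, ← mkN_zero, mkN_eq]
  refine ⟨⟨-(2 * 2 ^ s' * (c * v)), by ring⟩, ⟨-((2 * 2 ^ s' * d * u + w) * k), ?_⟩⟩
  rw [hw]; ring

theorem raw_rel {X Y : Equiv.Perm (NN s)} {c d e u v c2 d2 f u2 v2 : ℤ}
    (hX : ⇑X = aff s c d e u v) (hY : ⇑Y = aff s c2 d2 f u2 v2) :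
    X * Y * X = Y ↔
      2 ∣ c2 - ((c + c2 * e) + c * (f * e + 2 * 2 ^ s * d2 * c)) ∧
      2 ∣ d2 - (d + e * (d2 + f * d)) ∧
      (4 * 2 ^ s : ℤ) ∣ f - (e * (f * e + 2 * 2 ^ s * d2 * c) + 2 * 2 ^ s * d * (c + c2 * e)) ∧
      2 ∣ u2 - ((u + u2 + c2 * v) + u + c * (2 * 2 ^ s * d2 * u + f * v + v2)) ∧
      (4 * 2 ^ s : ℤ) ∣ v2 - (2 * 2 ^ s * d * (u + u2 + c2 * v) +
        e * (2 * 2 ^ s * d2 * u + f * v + v2) + v) := by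
  rw [← aff_eq, ← mul_eq_aff hX (mul_eq_aff hY hX), ← hY, mul_assoc]
  exact DFunLike.coe_injective.eq_iff.symm

theorem kj_of_rel {X Y : Equiv.Perm (NN s)} {c d e u v c2 d2 f u2 v2 : ℤ}
    (hX : ⇑X = aff s c d e u v) (hY : ⇑Y = aff s c2 d2 f u2 v2) (he : e % 4 = 1)
    (hf : f % 2 = 1) (hv : v % 2 = 1) (h : X * Y * X = Y) :
    (2 ^ s : ℤ) ∣ e - 1 ∧ (2 ^ s : ℤ) ∣ f + 1 := by
  obtain ⟨-, -, ⟨a, ha⟩, -, ⟨b, hb⟩⟩ := (raw_rel hX hY).1 h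
  obtain ⟨t, ht⟩ : ∃ t, e + 1 = 2 * (2 * t + 1) := ⟨e / 4, by omega⟩
  have h1 : (2 : ℤ) ^ s ∣ e - 1 := by
    apply pow_dvd_of_odd_mul (e := 2 * t + 1) (by omega)
    apply pow_dvd_of_odd_mul hf
    refine ⟨-(2 * a + e * d2 * c + d * (c + c2 * e)), ?_⟩
    have : 2 * (f * ((2 * t + 1) * (e - 1))) =
      2 * (2 ^ s * -(2 * a + e * d2 * c + d * (c + c2 * e))) := by
      linear_combination -ha - f * (e - 1) * ht
    linarith
  refine ⟨h1, ?_⟩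
  obtain ⟨k, hk⟩ := h1
  apply pow_dvd_of_odd_mul hv
  refine ⟨-(4 * b + 2 * d * (u + u2 + c2 * v) + 2 * e * d2 * u + k * v2 + k * f * v),
    ?_⟩
  linear_combination -hb - (f * v + v2) * hk

theorem cast_two {z : ℤ} : (2 : ℤ) ∣ z ↔ (2 : ZMod 4) * (z : ZMod 4) = 0 := by
  have : (2 : ZMod 4) * (z : ZMod 4) = ((2 * z : ℤ) : ZMod 4) := by push_cast; ring
  rw [this, ZMod.intCast_zmod_eq_zero_iff_dvd]
  push_cast
  omega

theorem cast_four {z : ℤ} : (4 * 2 ^ s : ℤ) ∣ 2 ^ s * z ↔ (z : ZMod 4) = 0 := by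
  rw [ZMod.intCast_zmod_eq_zero_iff_dvd, mul_comm (4 : ℤ)]
  exact mul_dvd_mul_iff_left (by positivity)

theorem cast_q (hs : 2 ≤ s) : (2 : ZMod 4) ^ s = 0 := by
  obtain ⟨s', rfl⟩ : ∃ s', s = s' + 2 := ⟨s - 2, by omega⟩
  rw [pow_add]
  have : (2 : ZMod 4) ^ 2 = 0 := by decide
  rw [this, mul_zero]

/-- First family of conditions. -/
def CondRel (c d k u v c2 d2 j u2 v2 : ZMod 4) : Prop :=
  2 * (c2 * v + c * (v2 - v)) = 0 ∧ 2 * (k + d * (c + c2) + d2 * c) = 0 ∧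
  (j - k) * v + k * v2 + 2 * (d * (u + c2 * v + u2) + d2 * u) = 0

/-- Second family of conditions. -/
def CondSq (ε c2 d2 j u2 v2 : ZMod 4) : Prop :=
  2 * (c2 * v2) = 0 ∧ 2 * j - 2 * (c2 * d2) = 0 ∧ 2 * ε - 2 * (d2 * u2) - j * v2 = 0

/-- The reduced orbit. -/
def Orb (c u v a b : ZMod 4) : Prop :=
  (b = 0 ∧ 2 * a = 0) ∨ (b = v ∧ 2 * a = 2 * u) ∨ (b = 2 ∧ 2 * a = 2 * c) ∨
    (b = v + 2 ∧ 2 * a = 2 * (c + u))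

theorem four_zero : (4 : ZMod 4) = 0 := by decide

theorem rel_iff (hs : 2 ≤ s) {X Y : Equiv.Perm (NN s)} {c d k u v c2 d2 j u2 v2 : ℤ}
    (hX : ⇑X = aff s c d (1 + 2 ^ s * k) u v)
    (hY : ⇑Y = aff s c2 d2 (-1 + 2 ^ s * j) u2 v2) :
    X * Y * X = Y ↔ CondRel c d k u v c2 d2 j u2 v2 := by
  rw [raw_rel hX hY]
  have e1 : (-1 + 2 ^ s * j) - ((1 + 2 ^ s * k) * ((-1 + 2 ^ s * j) * (1 + 2 ^ s * k) +
      2 * 2 ^ s * d2 * c) + 2 * 2 ^ s * d * (c + c2 * (1 + 2 ^ s * k))) =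
      2 ^ s * (-((-1 + 2 ^ s * j) * (2 * k + 2 ^ s * k * k) +
        2 * ((1 + 2 ^ s * k) * d2 * c + d * (c + c2 * (1 + 2 ^ s * k))))) := by ring
  have e2 : v2 - (2 * 2 ^ s * d * (u + u2 + c2 * v) +
        (1 + 2 ^ s * k) * (2 * 2 ^ s * d2 * u + (-1 + 2 ^ s * j) * v + v2) + v) =
      2 ^ s * (-(2 * d * (u + u2 + c2 * v) + 2 * (1 + 2 ^ s * k) * d2 * u +
        (j - k + 2 ^ s * k * j) * v + k * v2)) := by ring
  rw [e1, e2, cast_four, cast_four, cast_two, cast_two, cast_two]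
  push_cast
  rw [cast_q hs]
  have h4 := four_zero
  unfold CondRel
  constructor
  · rintro ⟨-, -, h3, h4', h5⟩
    refine ⟨?_, ?_, ?_⟩
    · linear_combination -h4' - (u : ZMod 4) * h4
    · linear_combination h3 + ((d : ZMod 4) * (c + c2) + d2 * c) * h4
    · linear_combination -h5
  · rintro ⟨h1, h2, h3⟩
    refine ⟨by ring, by ring, ?_, ?_, ?_⟩
    · linear_combination h2 - ((d : ZMod 4) * (c + c2) + d2 * c) * h4
    · linear_combination -h1 - (u : ZMod 4) * h4
    · linear_combination -h3

theorem sq_iff (hs : 2 ≤ s) {Y : Equiv.Perm (NN s)} {c2 d2 j u2 v2 ε : ℤ}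
    (hY : ⇑Y = aff s c2 d2 (-1 + 2 ^ s * j) u2 v2) :
    ⇑(Y * Y) = aff s 0 0 1 0 (2 * 2 ^ s * ε) ↔ CondSq ε c2 d2 j u2 v2 := by
  rw [mul_eq_aff hY hY, aff_eq]
  have e1 : 1 - ((-1 + 2 ^ s * j) * (-1 + 2 ^ s * j) + 2 * 2 ^ s * d2 * c2) =
      2 ^ s * (2 * j - 2 ^ s * j * j - 2 * d2 * c2) := by ring
  have e2 : 2 * 2 ^ s * ε - (2 * 2 ^ s * d2 * u2 + (-1 + 2 ^ s * j) * v2 + v2) =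
      2 ^ s * (2 * ε - 2 * (d2 * u2) - j * v2) := by ring
  rw [e1, e2, cast_four, cast_four, cast_two, cast_two, cast_two]
  push_cast
  rw [cast_q hs]
  have h4 := four_zero
  unfold CondSq
  constructor
  · rintro ⟨-, -, h3, h4', h5⟩
    refine ⟨?_, ?_, ?_⟩
    · linear_combination -h4' - (u2 : ZMod 4) * h4
    · linear_combination h3
    · linear_combination h5
  · rintro ⟨h1, h2, h3⟩
    refine ⟨by ring, by ring, ?_, ?_, ?_⟩
    · linear_combination h2
    · linear_combination -h1 - (u2 : ZMod 4) * h4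
    · linear_combination h3

theorem orb_wd {c u v : ZMod 4} {a b a' b' : ℤ} (h : mkN s a b = mkN s a' b')
    (ho : Orb c u v a b) : Orb c u v a' b' := by
  rw [mkN_eq] at h
  obtain ⟨h1, h2⟩ := h
  have h1 : (2 : ZMod 4) * (a' : ZMod 4) = 2 * a := by
    rw [cast_two] at h1; push_cast at h1; linear_combination h1
  have h2 : (b' : ZMod 4) = b := by
    have : (4 : ℤ) ∣ b' - b := (Dvd.intro _ rfl).trans h2
    rw [← sub_eq_zero, ← Int.cast_sub, ZMod.intCast_zmod_eq_zero_iff_dvd]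
    exact_mod_cast this
  unfold Orb at *
  rwa [h1, h2]

theorem orb_step {c u v a b : ZMod 4} (hv : 2 * v = 2) (h : Orb c u v a b) :
    Orb c u v (a + c * b + u) (b + v) := by
  have h4 := four_zero
  have hv4 : v + v = 2 := by linear_combination hv
  rcases h with ⟨h1, h2⟩ | ⟨h1, h2⟩ | ⟨h1, h2⟩ | ⟨h1, h2⟩ <;> subst h1
  · right; left
    exact ⟨by ring, by linear_combination h2⟩
  · right; right; left
    exact ⟨hv4, by linear_combination h2 + c * hv + u * h4⟩
  · right; right; right
    exact ⟨by ring, by linear_combination h2 + c * h4⟩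
  · left
    exact ⟨by linear_combination hv + h4, by linear_combination h2 + c * hv + (2 * c + u) * h4⟩

theorem orb_pow (hs : 2 ≤ s) {X : Equiv.Perm (NN s)} {c d k u v : ℤ} (hv : v % 2 = 1)
    (hX : ⇑X = aff s c d (1 + 2 ^ s * k) u v) {p : NN s}
    (hp : ∃ a b : ℤ, p = mkN s a b ∧ Orb c u v a b) (i : ℕ) :
    ∃ a b : ℤ, (X ^ i) p = mkN s a b ∧ Orb c u v a b := by
  have hv2 : (2 : ZMod 4) * (v : ZMod 4) = 2 := by
    have : (2 : ℤ) ∣ v - 1 := by omega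
    rw [cast_two] at this; push_cast at this; linear_combination this
  induction i with
  | zero => simpa using hp
  | succ i ih =>
    obtain ⟨a, b, h, ho⟩ := ih
    refine ⟨a + c * b + u, 2 * 2 ^ s * d * a + (1 + 2 ^ s * k) * b + v, ?_, ?_⟩
    · rw [pow_succ', Equiv.Perm.mul_apply, h, hX, aff_mkN]
    · have := orb_step hv2 ho
      push_cast
      rw [cast_q hs]
      simpa using this

end relations

end HGSCount

namespace HGSCount

/-- All conditions. -/
def Cond (ε c d k u v c2 d2 j u2 v2 : ZMod 4) : Prop :=
  2 * v = 2 ∧ CondSq ε c2 d2 j u2 v2 ∧ CondRel c d k u v c2 d2 j u2 v2 ∧ ¬ Orb c u v u2 v2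

instance (ε c d k u v c2 d2 j u2 v2 : ZMod 4) : Decidable (Cond ε c d k u v c2 d2 j u2 v2) := by
  unfold Cond CondSq CondRel Orb
  infer_instance

/-- The groups considered, through their presentation. -/
structure Pres (G : Type) [Group G] (s ε : ℕ) (x y : G) : Prop where
  pow : x ^ (2 ^ (s + 2)) = 1
  half : x ^ (2 ^ (s + 1)) ≠ 1
  rel : x * y * x = y
  sq : y * y = x ^ (ε * 2 ^ (s + 1))
  nf : ∀ g : G, (∃ i : ℕ, g = x ^ i) ∨ ∃ i : ℕ, g = x ^ i * y
  card : Nat.card G = 2 ^ (s + 3)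
  lift : ∀ (H : Type) [Group H] (X Y : H), X ^ (2 ^ (s + 2)) = 1 → X * Y * X = Y →
    Y * Y = X ^ (ε * 2 ^ (s + 1)) → ∃ φ : G →* H, φ x = X ∧ φ y = Y

section counting

variable {G : Type} [Group G] {s ε : ℕ} {x y : G}

theorem aff_one : aff s 0 0 1 0 0 = id := by
  funext p
  obtain ⟨a, b, rfl⟩ := exists_mkN p
  rw [aff_mkN]; simp

theorem pow_eps (hε : ε = 0 ∨ ε = 1) {X : Equiv.Perm (NN s)}
    (h : ⇑(X ^ (2 ^ (s + 1))) = aff s 0 0 1 0 (2 * 2 ^ s)) :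
    ⇑(X ^ (ε * 2 ^ (s + 1))) = aff s 0 0 1 0 (2 * 2 ^ s * (ε : ℤ)) := by
  rcases hε with rfl | rfl
  · simp [aff_one]
  · simpa using h

theorem pow_full {X : Equiv.Perm (NN s)}
    (h : ⇑(X ^ (2 ^ (s + 1))) = aff s 0 0 1 0 (2 * 2 ^ s)) : X ^ (2 ^ (s + 2)) = 1 := by
  have : X ^ (2 ^ (s + 2)) = X ^ (2 ^ (s + 1)) * X ^ (2 ^ (s + 1)) := by
    rw [← pow_add]; congr 1; ring
  rw [this]
  apply DFunLike.coe_injective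
  rw [mul_eq_aff h h]
  change _ = id
  rw [← aff_one, aff_eq]
  exact ⟨⟨0, by ring⟩, ⟨0, by ring⟩, ⟨0, by ring⟩, ⟨0, by ring⟩, ⟨-1, by ring⟩⟩

theorem half_ne {X : Equiv.Perm (NN s)}
    (h : ⇑(X ^ (2 ^ (s + 1))) = aff s 0 0 1 0 (2 * 2 ^ s)) : (X ^ (2 ^ (s + 1))) 0 ≠ 0 := by
  rw [h, aff_zero_apply, ← mkN_zero, Ne, mkN_eq]
  rintro ⟨-, w, hw⟩
  have : (2 : ℤ) ^ s * (2 * w + 1) = 0 := by linarith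
  rcases mul_eq_zero.1 this with h | h
  · exact absurd h (by positivity)
  · omega

theorem pow_zero_dvd {X : Equiv.Perm (NN s)}
    (h : ⇑(X ^ (2 ^ (s + 1))) = aff s 0 0 1 0 (2 * 2 ^ s)) {i : ℕ} (hi : (X ^ i) 0 = 0) :
    2 ^ (s + 2) ∣ i := by
  have hp : Function.minimalPeriod X 0 = 2 ^ (s + 1 + 1) := by
    have : Fact (Nat.Prime 2) := ⟨Nat.prime_two⟩
    apply Function.minimalPeriod_eq_prime_pow
    · intro hh
      apply half_ne h
      rw [Equiv.Perm.coe_pow]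
      exact hh
    · change (X^[2 ^ (s + 1 + 1)]) 0 = 0
      rw [← Equiv.Perm.coe_pow, pow_full h]; rfl
  have : 2 ^ (s + 2) = Function.minimalPeriod X 0 := hp.symm
  rw [this]
  apply Function.IsPeriodicPt.minimalPeriod_dvd
  change (X^[i]) 0 = 0
  rw [← Equiv.Perm.coe_pow, hi]

theorem cond_odd {v : ℤ} (h : (2 : ZMod 4) * (v : ZMod 4) = 2) : v % 2 = 1 := by
  have : (2 : ℤ) ∣ v - 1 := by
    rw [cast_two]; push_cast; linear_combination h
  omega

theorem e_mod (hs : 2 ≤ s) (k : ℤ) : (1 + 2 ^ s * k) % 4 = 1 ∧ (-1 + 2 ^ s * k) % 2 = 1 := by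
  obtain ⟨s', rfl⟩ : ∃ s', s = s' + 2 := ⟨s - 2, by omega⟩
  have : (2 : ℤ) ^ (s' + 2) * k = 4 * (2 ^ s' * k) := by ring
  omega

theorem card_NN : Nat.card (NN s) = 2 ^ (s + 3) := by
  simp; ring

theorem Pres.finite (P : Pres G s ε x y) : Finite G := by
  apply Nat.finite_of_card_ne_zero
  rw [P.card]; positivity

theorem Pres.exists_emb (P : Pres G s ε x y) (hs : 2 ≤ s) (hε : ε = 0 ∨ ε = 1)
    {c d k u v c2 d2 j u2 v2 : ℤ} (h : Cond (ε : ℤ) c d k u v c2 d2 j u2 v2) :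
    ∃ φ : RegEmb G (NN s), ⇑(φ.1 x) = aff s c d (1 + 2 ^ s * k) u v ∧
      ⇑(φ.1 y) = aff s c2 d2 (-1 + 2 ^ s * j) u2 v2 := by
  obtain ⟨hv, hsq, hrel, horb⟩ := h
  have hv := cond_odd hv
  have hk := (e_mod hs k).1
  obtain ⟨X, hX⟩ := exists_perm s c d (1 + 2 ^ s * k) u v (by omega)
  obtain ⟨Y, hY⟩ := exists_perm s c2 d2 (-1 + 2 ^ s * j) u2 v2 (e_mod hs j).2
  have hhalf := pow_half hs hk hv hX
  rw [← rel_iff hs hX hY] at hrel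
  rw [← sq_iff hs hY, ← pow_eps hε hhalf] at hsq
  obtain ⟨φ, hx, hy⟩ := P.lift _ X Y (pow_full hhalf) hrel (DFunLike.coe_injective hsq)
  have haff : ∀ g, IsAffinePerm (φ g) := by
    have hmul : ∀ A B : Equiv.Perm (NN s), IsAffinePerm A → IsAffinePerm B →
        IsAffinePerm (A * B) := by
      intro A B hA hB
      obtain ⟨_, _, _, _, _, _, hA⟩ := eq_aff_of_isAffine hA
      obtain ⟨_, _, _, _, _, _, hB⟩ := eq_aff_of_isAffine hB
      exact isAffine_of_eq (mul_eq_aff hA hB)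
    have hpow : ∀ i : ℕ, IsAffinePerm (X ^ i) := by
      intro i
      induction i with
      | zero => intro a b; simp
      | succ i ih => exact hmul (X ^ i) X ih (isAffine_of_eq hX)
    intro g
    rcases P.nf g with ⟨i, rfl⟩ | ⟨i, rfl⟩
    · rw [map_pow, hx]; exact hpow i
    · rw [map_mul, map_pow, hx, hy]; exact hmul _ _ (hpow i) (isAffine_of_eq hY)
  have hstab : ∀ g, φ g 0 = 0 → g = 1 := by
    intro g hg
    rcases P.nf g with ⟨i, rfl⟩ | ⟨i, rfl⟩
    · rw [map_pow, hx] at hg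
      obtain ⟨w, rfl⟩ := pow_zero_dvd hhalf hg
      rw [pow_mul, P.pow, one_pow]
    · exfalso
      rw [map_mul, map_pow, hx, hy, Equiv.Perm.mul_apply] at hg
      have hY0 : Y 0 = mkN s u2 v2 := by rw [hY, aff_zero_apply]
      -- `Y 0` lies in the orbit of zero
      have h1 : Y 0 = (X ^ (i * (2 ^ (s + 2) - 1))) 0 := by
        have h2 : X ^ (i * (2 ^ (s + 2) - 1)) * X ^ i = 1 := by
          rw [← pow_add]
          have : i * (2 ^ (s + 2) - 1) + i = 2 ^ (s + 2) * i := by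
            have := Nat.one_le_two_pow (n := s + 2)
            obtain ⟨w, hw⟩ := Nat.exists_eq_add_of_le this
            rw [hw]; simp; ring
          rw [this, pow_mul, pow_full hhalf, one_pow]
        have h3 := congrArg (fun A : Equiv.Perm (NN s) => A (Y 0)) h2
        simp only [Equiv.Perm.mul_apply, hg, Equiv.Perm.one_apply] at h3
        exact h3.symm
      obtain ⟨a, b, hab, ho⟩ := orb_pow hs hv hX (p := 0)
        ⟨0, 0, (mkN_zero s).symm, Or.inl (by simp)⟩ (i * (2 ^ (s + 2) - 1))
      rw [← h1, hY0] at hab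
      exact horb (orb_wd hab.symm ho)
  have hinj : Function.Injective (fun g => φ g 0) := by
    intro g h hgh
    have : h⁻¹ * g = 1 := by
      apply hstab
      have hgh : φ g 0 = φ h 0 := hgh
      rw [map_mul, Equiv.Perm.mul_apply, hgh, ← Equiv.Perm.mul_apply, ← map_mul]
      simp
    exact (inv_mul_eq_one.1 this).symm
  have := P.finite
  refine ⟨⟨φ, haff, ?_⟩, by rw [← hX, ← hx], by rw [← hY, ← hy]⟩
  exact (Nat.bijective_iff_injective_and_card _).2 ⟨hinj, by rw [P.card, card_NN]⟩

theorem Pres.cond_of_emb (P : Pres G s ε x y) (hs : 2 ≤ s)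
    (φ : RegEmb G (NN s)) : ∃ c d k u v c2 d2 j u2 v2 : ℤ,
      ⇑(φ.1 x) = aff s c d (1 + 2 ^ s * k) u v ∧
      ⇑(φ.1 y) = aff s c2 d2 (-1 + 2 ^ s * j) u2 v2 := by
  obtain ⟨c, d, e, u, v, he, hX⟩ := eq_aff_of_isAffine (φ.2.1 x)
  obtain ⟨c2, d2, f, u2, v2, hf, hY⟩ := eq_aff_of_isAffine (φ.2.1 y)
  have hne : ((φ.1 x) ^ (2 ^ (s + 1))) 0 ≠ 0 := by
    intro h
    apply P.half
    apply φ.2.2.1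
    simpa using h
  obtain ⟨he, hv⟩ := odd_of_half hs he hX hne
  obtain ⟨⟨k, hk⟩, ⟨j, hj⟩⟩ := kj_of_rel hX hY he hf hv (by rw [← map_mul, ← map_mul, P.rel])
  obtain rfl : e = 1 + 2 ^ s * k := by linarith
  obtain rfl : f = -1 + 2 ^ s * j := by linarith
  exact ⟨c, d, k, u, v, c2, d2, j, u2, v2, hX, hY⟩

theorem Pres.cond_of_emb' (P : Pres G s ε x y) (hs : 2 ≤ s) (hε : ε = 0 ∨ ε = 1)
    (φ : RegEmb G (NN s)) {c d k u v c2 d2 j u2 v2 : ℤ}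
      (hX : ⇑(φ.1 x) = aff s c d (1 + 2 ^ s * k) u v)
      (hY : ⇑(φ.1 y) = aff s c2 d2 (-1 + 2 ^ s * j) u2 v2) :
      Cond (ε : ℤ) c d k u v c2 d2 j u2 v2 := by
  have hne : ((φ.1 x) ^ (2 ^ (s + 1))) 0 ≠ 0 := by
    intro h
    apply P.half
    apply φ.2.2.1
    simpa using h
  have hk := (e_mod hs k).1
  obtain ⟨-, hv⟩ := odd_of_half hs (by omega) hX hne
  have hhalf := pow_half hs hk hv hX
  have hv2 : (2 : ZMod 4) * (v : ZMod 4) = 2 := by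
    have : (2 : ℤ) ∣ v - 1 := by omega
    rw [cast_two] at this; push_cast at this; linear_combination this
  refine ⟨hv2, ?_, ?_, ?_⟩
  · rw [← sq_iff hs hY, ← pow_eps hε hhalf, ← map_mul, P.sq, map_pow]
  · rw [← rel_iff hs hX hY, ← map_mul, ← map_mul, P.rel]
  · intro ho
    obtain ⟨g, hg⟩ := φ.2.2.2 (mkN s 1 0)
    have hg : φ.1 g 0 = mkN s 1 0 := hg
    have key : ∃ a b : ℤ, φ.1 g 0 = mkN s a b ∧ Orb c u v a b := by
      rcases P.nf g with ⟨i, rfl⟩ | ⟨i, rfl⟩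
      · rw [map_pow]
        exact orb_pow hs hv hX ⟨0, 0, (mkN_zero s).symm, Or.inl (by simp)⟩ i
      · rw [map_mul, map_pow, Equiv.Perm.mul_apply]
        exact orb_pow hs hv hX ⟨u2, v2, by rw [hY, aff_zero_apply], ho⟩ i
    obtain ⟨a, b, hab, hO⟩ := key
    rw [hg] at hab
    have h1 := orb_wd hab.symm hO
    revert h1 hv2
    generalize (c : ZMod 4) = c'
    generalize (u : ZMod 4) = u'
    generalize (v : ZMod 4) = v'
    unfold Orb
    push_cast
    revert c' u' v'
    decide

/-- Reduced parameters of one affine map. -/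
abbrev RP : Type := Fin 2 × Fin 2 × Fin 4 × Fin 2 × Fin 4

/-- The condition on reduced parameters. -/
abbrev RCond (ε : ℕ) (p : RP × RP) : Prop :=
  Cond (ε : ZMod 4) (p.1.1 : ℕ) (p.1.2.1 : ℕ) (p.1.2.2.1 : ℕ) (p.1.2.2.2.1 : ℕ)
    (p.1.2.2.2.2 : ℕ) (p.2.1 : ℕ) (p.2.2.1 : ℕ) (p.2.2.2.1 : ℕ) (p.2.2.2.2.1 : ℕ)
    (p.2.2.2.2.2 : ℕ)

instance (ε c2 d2 j u2 v2 : ZMod 4) : Decidable (CondSq ε c2 d2 j u2 v2) := by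
  unfold CondSq
  infer_instance

instance (c d k u v c2 d2 j u2 v2 : ZMod 4) : Decidable (CondRel c d k u v c2 d2 j u2 v2 ∧ ¬ Orb c u v u2 v2) := by
  unfold CondRel Orb
  infer_instance

theorem card_RCond_split (ε : ℕ) : Fintype.card {p : RP × RP // RCond ε p} =
    ∑ q : RP, if CondSq (ε : ZMod 4) (q.1 : ℕ) (q.2.1 : ℕ) (q.2.2.1 : ℕ) (q.2.2.2.1 : ℕ)
        (q.2.2.2.2 : ℕ) then
      ∑ p : RP, if 2 * ((p.2.2.2.2 : ℕ) : ZMod 4) = 2 ∧ (CondRel (p.1 : ℕ) (p.2.1 : ℕ) (p.2.2.1 : ℕ)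
        (p.2.2.2.1 : ℕ) (p.2.2.2.2 : ℕ) (q.1 : ℕ) (q.2.1 : ℕ) (q.2.2.1 : ℕ) (q.2.2.2.1 : ℕ)
        (q.2.2.2.2 : ℕ) ∧ ¬ Orb (p.1 : ℕ) (p.2.2.2.1 : ℕ) (p.2.2.2.2 : ℕ) (q.2.2.2.1 : ℕ)
        (q.2.2.2.2 : ℕ)) then 1 else 0 else 0 := by
  rw [Fintype.card_subtype, Finset.card_filter, Fintype.sum_prod_type_right]
  refine Finset.sum_congr rfl fun q _ => ?_
  split_ifs with h
  · refine Finset.sum_congr rfl fun p _ => ?_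
    refine if_congr ?_ rfl rfl
    simp only [RCond, Cond, h, true_and]
  · refine Finset.sum_eq_zero fun p _ => if_neg ?_
    simp only [RCond, Cond, h, false_and, and_false, not_false_eq_true]

set_option maxRecDepth 100000 in
theorem card_RCond_zero : Fintype.card {p : RP × RP // RCond 0 p} = 128 := by
  rw [card_RCond_split]
  decide +kernel

set_option maxRecDepth 100000 in
theorem card_RCond_one : Fintype.card {p : RP × RP // RCond 1 p} = 128 := by
  rw [card_RCond_split]
  decide +kernel

theorem card_RCond (hε : ε = 0 ∨ ε = 1) : Nat.card {p : RP × RP // RCond ε p} = 128 := by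
  rw [Nat.card_eq_fintype_card]
  rcases hε with rfl | rfl
  · exact card_RCond_zero
  · exact card_RCond_one

/-- The affine map attached to reduced parameters. -/
def pa (s : ℕ) (z : ℤ) (p : RP) (h : Fin (2 ^ s)) : NN s → NN s :=
  aff s (p.1 : ℤ) (p.2.1 : ℤ) (z + 2 ^ s * (p.2.2.1 : ℤ)) (p.2.2.2.1 : ℤ)
    ((p.2.2.2.2 : ℤ) + 4 * (h : ℤ))

theorem pa_inj {z : ℤ} {p p' : RP} {h h' : Fin (2 ^ s)} (H : pa s z p h = pa s z p' h') :
    p = p' ∧ h = h' := by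
  unfold pa at H
  rw [aff_eq] at H
  obtain ⟨h1, h2, h3, h4, h5⟩ := H
  obtain ⟨c, d, k, u, r⟩ := p
  obtain ⟨c', d', k', u', r'⟩ := p'
  dsimp only at h1 h2 h3 h4 h5
  have h3 : (4 : ℤ) ∣ (k' : ℤ) - (k : ℤ) := by
    have h6 : (2 ^ s : ℤ) * 4 ∣ 2 ^ s * ((k' : ℤ) - (k : ℤ)) := by
      obtain ⟨w, hw⟩ := h3
      exact ⟨w, by linear_combination hw⟩
    exact Int.dvd_of_mul_dvd_mul_left (by positivity) h6
  have h5 : ((r' : ℤ) + 4 * (h' : ℤ)) - ((r : ℤ) + 4 * (h : ℤ)) = 0 := by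
    apply Int.eq_zero_of_abs_lt_dvd h5
    have := h.2
    have := h'.2
    have := r.2
    have := r'.2
    have e : (2 : ℤ) ^ s = ((2 ^ s : ℕ) : ℤ) := by push_cast; rfl
    rw [e, abs_lt]
    generalize 2 ^ s = q at *
    omega
  have h6 : r = r' := by
    apply Fin.ext; omega
  have h7 : h = h' := by
    apply Fin.ext; omega
  have := fin_eq_of_dvd h1
  have := fin_eq_of_dvd h2
  have := fin_eq_of_dvd h3
  have := fin_eq_of_dvd h4
  subst_vars
  exact ⟨rfl, rfl⟩

theorem pa_exists (z c d k u v : ℤ) :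
    ∃ (p : RP) (h : Fin (2 ^ s)), aff s c d (z + 2 ^ s * k) u v = pa s z p h := by
  obtain ⟨c', hc⟩ := exists_fin 2 (by norm_num) c
  obtain ⟨d', hd⟩ := exists_fin 2 (by norm_num) d
  obtain ⟨k', hk⟩ := exists_fin 4 (by norm_num) k
  obtain ⟨u', hu⟩ := exists_fin 2 (by norm_num) u
  obtain ⟨v', hv⟩ := exists_fin (2 ^ (s + 2)) (by positivity) v
  have hv' := v'.2
  refine ⟨(c', d', k', u', ⟨v' % 4, by omega⟩), ⟨v' / 4, ?_⟩, ?_⟩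
  · have : 2 ^ (s + 2) = 4 * 2 ^ s := by ring
    omega
  · unfold pa
    rw [aff_eq]
    refine ⟨hc, hd, ?_, hu, ?_⟩
    · obtain ⟨w, hw⟩ := hk
      exact ⟨w, by push_cast at hw; linear_combination 2 ^ s * hw⟩
    · rw [modulus_cast] at hv
      have : (((v' : ℕ) % 4 : ℕ) : ℤ) + 4 * (((v' : ℕ) / 4 : ℕ) : ℤ) = (v' : ℕ) := by omega
      dsimp only
      rw [this]
      exact hv

theorem cond_cast {p : RP × RP} {h h' : Fin (2 ^ s)} :
    Cond ((ε : ℤ) : ZMod 4) ((p.1.1 : ℤ) : ZMod 4) ((p.1.2.1 : ℤ) : ZMod 4)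
      ((p.1.2.2.1 : ℤ) : ZMod 4) ((p.1.2.2.2.1 : ℤ) : ZMod 4)
      (((p.1.2.2.2.2 : ℤ) + 4 * (h : ℤ) : ℤ) : ZMod 4)
      ((p.2.1 : ℤ) : ZMod 4) ((p.2.2.1 : ℤ) : ZMod 4)
      ((p.2.2.2.1 : ℤ) : ZMod 4) ((p.2.2.2.2.1 : ℤ) : ZMod 4)
      (((p.2.2.2.2.2 : ℤ) + 4 * (h' : ℤ) : ℤ) : ZMod 4) ↔ RCond ε p := by
  have key : ∀ a b : ℤ, ((a + 4 * b : ℤ) : ZMod 4) = a := by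
    intro a b
    push_cast
    linear_combination (b : ZMod 4) * four_zero
  unfold RCond
  rw [key, key]
  simp only [Int.cast_natCast]

theorem Pres.card_emb (P : Pres G s ε x y) (hs : 2 ≤ s) (hε : ε = 0 ∨ ε = 1) :
    Nat.card (RegEmb G (NN s)) = 128 * (2 ^ s * 2 ^ s) := by
  have hex : ∀ t : {p : RP × RP // RCond ε p} × Fin (2 ^ s) × Fin (2 ^ s),
      ∃ φ : RegEmb G (NN s), ⇑(φ.1 x) = pa s 1 t.1.1.1 t.2.1 ∧
        ⇑(φ.1 y) = pa s (-1) t.1.1.2 t.2.2 := by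
    intro t
    exact P.exists_emb hs hε (cond_cast.2 t.1.2)
  choose F hFx hFy using hex
  have hbij : Function.Bijective F := by
    constructor
    · rintro ⟨⟨⟨p1, p2⟩, hp⟩, h1, h2⟩ ⟨⟨⟨p1', p2'⟩, hp'⟩, h1', h2'⟩ hF
      have hx := hFx ⟨⟨⟨p1, p2⟩, hp⟩, h1, h2⟩
      rw [hF, hFx] at hx
      have hy := hFy ⟨⟨⟨p1, p2⟩, hp⟩, h1, h2⟩
      rw [hF, hFy] at hy
      obtain ⟨e1, e2⟩ := pa_inj hx
      obtain ⟨e3, e4⟩ := pa_inj hy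
      dsimp only at e1 e2 e3 e4
      subst e1 e2 e3 e4
      rfl
    · intro φ
      obtain ⟨c, d, k, u, v, c2, d2, j, u2, v2, hX, hY⟩ := P.cond_of_emb hs φ
      obtain ⟨p, h, hp⟩ := pa_exists (s := s) 1 c d k u v
      obtain ⟨p', h', hp'⟩ := pa_exists (s := s) (-1) c2 d2 j u2 v2
      rw [hp] at hX
      rw [hp'] at hY
      have hc := P.cond_of_emb' hs hε φ hX hY
      refine ⟨(⟨(p, p'), cond_cast.1 hc⟩, h, h'), ?_⟩
      apply Subtype.ext
      have ex : (F (⟨(p, p'), cond_cast.1 hc⟩, h, h')).1 x = φ.1 x :=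
        DFunLike.coe_injective ((hFx _).trans hX.symm)
      have ey : (F (⟨(p, p'), cond_cast.1 hc⟩, h, h')).1 y = φ.1 y :=
        DFunLike.coe_injective ((hFy _).trans hY.symm)
      refine MonoidHom.ext fun g => ?_
      rcases P.nf g with ⟨i, rfl⟩ | ⟨i, rfl⟩
      · rw [map_pow, map_pow, ex]
      · rw [map_mul, map_mul, map_pow, map_pow, ex, ey]
  rw [← Nat.card_congr (Equiv.ofBijective F hbij), Nat.card_prod, Nat.card_prod, card_RCond hε]
  simp

theorem Pres.card_HGS (P : Pres G s ε x y) (hs : 2 ≤ s) (hε : ε = 0 ∨ ε = 1) :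
    Nat.card (HGS G (NN s)) = 2 ^ (s + 4) := by
  have h1 := card_HGS_mul (G := G) (N := NN s)
  rw [card_addAut, P.card_emb hs hε] at h1
  have h2 : (8 * 2 ^ s) ≠ 0 := by positivity
  apply Nat.eq_of_mul_eq_mul_right (Nat.pos_of_ne_zero h2)
  rw [h1]; ring

theorem exists_zpowers {H : Type} [Group H] {R : ℕ} [NeZero R] {X Y : H} (hX : X ^ R = 1)
    (hrel : X * Y * X = Y) : ∃ Q : ZMod R → H, (∀ i j, Q (i + j) = Q i * Q j) ∧
      (∀ k : ℕ, Q k = X ^ k) ∧ ∀ i, Q i * Y = Y * Q (-i) := by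
  have hadd : ∀ i j : ZMod R, X ^ (i + j).val = X ^ i.val * X ^ j.val := by
    intro i j
    rw [ZMod.val_add, ← pow_eq_pow_mod _ hX, pow_add]
  refine ⟨fun i => X ^ i.val, hadd, ?_, ?_⟩
  · intro k
    simp only [ZMod.val_natCast]
    rw [← pow_eq_pow_mod _ hX]
  · have hk : ∀ k : ℕ, X ^ k * Y * X ^ k = Y := by
      intro k
      induction k with
      | zero => simp
      | succ k ih =>
        calc X ^ (k + 1) * Y * X ^ (k + 1) = X ^ k * (X * Y * X) * X ^ k := by
              rw [pow_succ X k]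
              nth_rewrite 2 [← pow_succ X k]
              rw [pow_succ' X k]; group
          _ = Y := by rw [hrel, ih]
    intro i
    have h1 := hk i.val
    have h2 := hadd i (-i)
    rw [add_neg_cancel, ZMod.val_zero, pow_zero] at h2
    dsimp only
    calc X ^ i.val * Y = X ^ i.val * Y * (X ^ i.val * X ^ (-i).val) := by rw [← h2, mul_one]
      _ = (X ^ i.val * Y * X ^ i.val) * X ^ (-i).val := by group
      _ = _ := by rw [h1]

theorem two_mul_pow_lt (s : ℕ) : 2 ^ (s + 1) < 2 ^ (s + 2) :=
  Nat.pow_lt_pow_right (by norm_num) (by omega)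

theorem pres_dihedral (s : ℕ) : Pres (DihedralGroup (2 ^ (s + 2))) s 0
    (DihedralGroup.r 1) (DihedralGroup.sr 0) where
  pow := DihedralGroup.r_one_pow_n
  half h := by
    have := orderOf_dvd_of_pow_eq_one h
    rw [DihedralGroup.orderOf_r_one] at this
    exact absurd (Nat.le_of_dvd (by positivity) this) (not_le.2 (two_mul_pow_lt s))
  rel := by simp
  sq := by simp
  nf g := by
    rcases g with i | i
    · left; exact ⟨i.val, by simp⟩
    · right; exact ⟨(-i).val, by simp⟩
  card := by rw [DihedralGroup.nat_card]; ring
  lift H _ X Y hX hrel hsq := by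
    obtain ⟨Q, h1, h2, h3⟩ := exists_zpowers (R := 2 ^ (s + 2)) hX hrel
    have hsq : Y * Y = 1 := by simpa using hsq
    refine ⟨MonoidHom.mk' (fun g => match g with
      | .r i => Q i
      | .sr i => Y * Q i) ?_, ?_, ?_⟩
    · rintro (i | i) (j | j)
      · exact h1 i j
      · change Y * Q (j - i) = Q i * (Y * Q j)
        rw [← mul_assoc, h3, mul_assoc, ← h1, neg_add_eq_sub]
      · change Y * Q (i + j) = Y * Q i * Q j
        rw [h1, mul_assoc]
      · change Q (j - i) = Y * Q i * (Y * Q j)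
        rw [mul_assoc, ← mul_assoc (Q i), h3, ← mul_assoc, ← mul_assoc, hsq, one_mul, ← h1,
          neg_add_eq_sub]
    · change Q 1 = X
      simpa using h2 1
    · change Y * Q 0 = Y
      simpa using h2 0

theorem pres_quaternion (s : ℕ) : Pres (QuaternionGroup (2 ^ (s + 1))) s 1
    (QuaternionGroup.a 1) (QuaternionGroup.xa 0) where
  pow := by
    have h : 2 ^ (s + 2) = 2 * 2 ^ (s + 1) := by ring
    exact (congrArg _ h).trans (QuaternionGroup.a_one_pow_n (n := 2 ^ (s + 1)))
  half h := by
    have := orderOf_dvd_of_pow_eq_one h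
    rw [QuaternionGroup.orderOf_a_one] at this
    have := Nat.le_of_dvd (by positivity) this
    have : 0 < 2 ^ (s + 1) := by positivity
    omega
  rel := by simp
  sq := by simp
  nf g := by
    rcases g with i | i
    · left; exact ⟨i.val, by simp⟩
    · right; exact ⟨(-i).val, by simp⟩
  card := by rw [Nat.card_eq_fintype_card, QuaternionGroup.card]; ring
  lift H _ X Y hX hrel hsq := by
    have hX' : X ^ (2 * 2 ^ (s + 1)) = 1 := by
      rw [← hX]; congr 1; ring
    obtain ⟨Q, h1, h2, h3⟩ := exists_zpowers (R := 2 * 2 ^ (s + 1)) hX' hrel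
    have hsq : Y * Y = Q ((2 ^ (s + 1) : ℕ)) := by rw [h2, hsq, one_mul]
    refine ⟨MonoidHom.mk' (fun g => match g with
      | .a i => Q i
      | .xa i => Y * Q i) ?_, ?_, ?_⟩
    · rintro (i | i) (j | j)
      · exact h1 i j
      · change Y * Q (j - i) = Q i * (Y * Q j)
        rw [← mul_assoc, h3, mul_assoc, ← h1, neg_add_eq_sub]
      · change Y * Q (i + j) = Y * Q i * Q j
        rw [h1, mul_assoc]
      · change Q (((2 ^ (s + 1) : ℕ) : ZMod (2 * 2 ^ (s + 1))) + j - i) = Y * Q i * (Y * Q j)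
        rw [mul_assoc, ← mul_assoc (Q i), h3, ← mul_assoc, ← mul_assoc, hsq, ← h1, ← h1]
        congr 1
        ring
    · change Q 1 = X
      simpa using h2 1
    · change Y * Q 0 = Y
      simpa using h2 0

end counting
end HGSCount

/-- Proposition 6.4: a Galois extension of degree `2 ^ n` (`n ≥ 5`) with quaternion
or dihedral Galois group admits exactly `2 ^ (n + 1)` Hopf–Galois structures of type
`C₂ × C_{2^{n-1}}`, via the Greither–Pareigis correspondence. -/
theorem card_HGS_type_C2_x_C2pow_on_quaternion_or_dihedral (n : ℕ) (hn : 5 ≤ n) :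
    Nat.card {M : Subgroup (Equiv.Perm (QuaternionGroup (2 ^ (n - 2)))) //
      IsRegularPermSubgroup M ∧ IsNormalizedByLeftTranslations M ∧
      Nonempty (M ≃* Multiplicative (ZMod 2 × ZMod (2 ^ (n - 1))))} = 2 ^ (n + 1) ∧
    Nat.card {M : Subgroup (Equiv.Perm (DihedralGroup (2 ^ (n - 1)))) //
      IsRegularPermSubgroup M ∧ IsNormalizedByLeftTranslations M ∧
      Nonempty (M ≃* Multiplicative (ZMod 2 × ZMod (2 ^ (n - 1))))} = 2 ^ (n + 1) := by
  obtain ⟨s, rfl⟩ : ∃ s, n = s + 3 := ⟨n - 3, by omega⟩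
  have hs : 2 ≤ s := by omega
  exact ⟨(HGSCount.pres_quaternion s).card_HGS hs (Or.inr rfl),
    (HGSCount.pres_dihedral s).card_HGS hs (Or.inl rfl)⟩
end

section
/- Let s ≥ 3 be an odd integer and let n ≥ 2 be an integer. Then the automorphism group of the generalised quaternion group Q_{2^n s} of order 2^n s (QuaternionGroup (2^{n-2}·s)) and the automorphism group of the dihedral group D_{2^n s} of order 2^n s (DihedralGroup (2^{n-1}·s)) both have cardinality 2^{2n-3} · s · φ(s), where φ is Euler's totient function. -/
namespace AutCard

open DihedralGroup in
/-- The affine automorphism of the dihedral group attached to a unit and a translation. -/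
def dihAut (N : ℕ) (p : (ZMod N)ˣ × ZMod N) : MulAut (DihedralGroup N) where
  toFun
    | r i => r (p.1 * i)
    | sr i => sr (p.1 * i + p.2)
  invFun
    | r i => r (p.1⁻¹ * i)
    | sr i => sr (p.1⁻¹ * (i - p.2))
  left_inv := by rintro (x | x) <;> simp
  right_inv := by rintro (x | x) <;> simp
  map_mul' := by rintro (x | x) (y | y) <;> simp <;> ring

open DihedralGroup in
theorem dihAut_bijective (N : ℕ) (hN : 3 ≤ N) : Function.Bijective (dihAut N) := by
  have : NeZero N := ⟨by omega⟩
  have key : ∀ f : MulAut (DihedralGroup N), ∃ u : ZMod N, ∀ i, f (r i) = r (u * i) := by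
    intro f
    have h1 : orderOf (f (r 1)) = N := by
      rw [MulEquiv.orderOf_eq, orderOf_r_one]
    rcases h : f (r 1) with u | u
    · refine ⟨u, fun i => ?_⟩
      have hi : (r i : DihedralGroup N) = (r 1) ^ i.val := by simp
      rw [hi, map_pow, h]
      simp
    · rw [h, orderOf_sr] at h1
      omega
  constructor
  · rintro ⟨u, b⟩ ⟨v, c⟩ h
    have h1 := DFunLike.congr_fun h (r 1)
    have h2 := DFunLike.congr_fun h (sr 0)
    simp [dihAut] at h1 h2
    simp [Units.ext_iff, h1, h2]
  · intro f
    obtain ⟨u, hu⟩ := key f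
    obtain ⟨v, hv⟩ := key f.symm
    have huv : u * v = 1 := by
      have h := f.apply_symm_apply (r 1)
      rw [hv, hu] at h
      simpa using r.inj h
    rcases h : f (sr 0) with b | b
    · exfalso
      have h' := f.symm_apply_apply (sr 0)
      rw [h, hv] at h'
      cases h'
    · refine ⟨⟨⟨u, v, huv, (mul_comm v u).trans huv⟩, b⟩, ?_⟩
      ext x
      rcases x with i | i
      · simp [dihAut, hu]
      · have hi : (sr i : DihedralGroup N) = sr 0 * r i := by simp
        have : f (sr i) = sr (b + u * i) := by rw [hi, map_mul, h, hu, sr_mul_r]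
        rw [this]
        simp [dihAut, add_comm]

theorem unit_mul_half (m : ℕ) (hm : 0 < m) (u : (ZMod (2 * m))ˣ) :
    (u : ZMod (2 * m)) * m = m := by
  have : NeZero (2 * m) := ⟨by omega⟩
  have hc := ZMod.val_coe_unit_coprime u
  have hodd : Odd (u : ZMod (2 * m)).val :=
    (Nat.coprime_two_right).1 (Nat.Coprime.coprime_mul_right_right hc)
  obtain ⟨k, hk⟩ := hodd
  have h0 : ((2 * m : ℕ) : ZMod (2 * m)) = 0 := ZMod.natCast_self _
  have : (u : ZMod (2 * m)) = ((2 * k + 1 : ℕ) : ZMod (2 * m)) := by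
    rw [← hk, ZMod.natCast_zmod_val]
  rw [this]
  push_cast at h0 ⊢
  linear_combination (k : ZMod (2 * m)) * h0

open QuaternionGroup in
/-- The affine automorphism of the quaternion group attached to a unit and a translation. -/
def quatAut (m : ℕ) (hm : 0 < m) (p : (ZMod (2 * m))ˣ × ZMod (2 * m)) :
    MulAut (QuaternionGroup m) where
  toFun
    | a i => a (p.1 * i)
    | xa i => xa (p.1 * i + p.2)
  invFun
    | a i => a (p.1⁻¹ * i)
    | xa i => xa (p.1⁻¹ * (i - p.2))
  left_inv := by rintro (x | x) <;> simp
  right_inv := by rintro (x | x) <;> simp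
  map_mul' := by
    have hp := unit_mul_half m hm p.1
    rintro (x | x) (y | y) <;> simp
    · ring
    · ring
    · ring
    · linear_combination hp

open QuaternionGroup in
theorem quatAut_bijective (m : ℕ) (hm : 0 < m) (hm3 : 3 ≤ m) :
    Function.Bijective (quatAut m hm) := by
  have : NeZero m := ⟨by omega⟩
  have apow : ∀ (i : ZMod (2 * m)) (k : ℕ), (a i : QuaternionGroup m) ^ k = a (i * (k : ZMod (2 * m))) := by
    intro i k
    induction k with
    | zero => simp
    | succ k ih => rw [pow_succ, ih, a_mul_a]; congr 1; push_cast; ring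
  have key : ∀ f : MulAut (QuaternionGroup m),
      ∃ u : ZMod (2 * m), ∀ i, f (a i) = a (u * i) := by
    intro f
    have h1 : orderOf (f (a 1)) = 2 * m := by
      rw [MulEquiv.orderOf_eq, orderOf_a_one]
    rcases h : f (a 1) with u | u
    · refine ⟨u, fun i => ?_⟩
      have hi : (a i : QuaternionGroup m) = (a 1) ^ i.val := by simp
      rw [hi, map_pow, h, apow]
      simp
    · rw [h, orderOf_xa] at h1
      omega
  constructor
  · rintro ⟨u, b⟩ ⟨v, c⟩ h
    have h1 := DFunLike.congr_fun h (a 1)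
    have h2 := DFunLike.congr_fun h (xa 0)
    simp [quatAut] at h1 h2
    simp [Units.ext_iff, h1, h2]
  · intro f
    obtain ⟨u, hu⟩ := key f
    obtain ⟨v, hv⟩ := key f.symm
    have huv : u * v = 1 := by
      have h := f.apply_symm_apply (a 1)
      rw [hv, hu] at h
      simpa using a.inj h
    rcases h : f (xa 0) with b | b
    · exfalso
      have h' := f.symm_apply_apply (xa 0)
      rw [h, hv] at h'
      cases h'
    · refine ⟨⟨⟨u, v, huv, (mul_comm v u).trans huv⟩, b⟩, ?_⟩
      ext x
      rcases x with i | i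
      · simp [quatAut, hu]
      · have hi : (xa i : QuaternionGroup m) = xa 0 * a i := by simp
        have : f (xa i) = xa (b + u * i) := by rw [hi, map_mul, h, hu, xa_mul_a]
        rw [this]
        simp [quatAut, add_comm]

theorem card_units_prod (N : ℕ) (hN : 0 < N) :
    Nat.card ((ZMod N)ˣ × ZMod N) = Nat.totient N * N := by
  have : NeZero N := ⟨by omega⟩
  rw [Nat.card_prod, Nat.card_zmod, Nat.card_eq_fintype_card, ZMod.card_units_eq_totient]

theorem arith (s k : ℕ) (hs : Odd s) :
    Nat.totient (2 ^ (k + 1) * s) * (2 ^ (k + 1) * s) = 2 ^ (2 * k + 1) * s * Nat.totient s := by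
  have hc : Nat.Coprime (2 ^ (k + 1)) s := Nat.Coprime.pow_left _ (Nat.coprime_two_left.2 hs)
  rw [Nat.totient_mul hc, Nat.totient_prime_pow Nat.prime_two (by omega)]
  simp
  ring

end AutCard

/-- Proposition 13.1: for `s ≥ 3` odd and `n ≥ 2`, the automorphism groups of the
generalised quaternion group `Q_{2^n s}` and of the dihedral group `D_{2^n s}` both
have cardinality `2^(2n-3) · s · φ(s)`. -/
theorem card_mulAut_quaternion_dihedral_general (s n : ℕ) (hs : Odd s) (hs3 : 3 ≤ s)
    (hn : 2 ≤ n) :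
    Nat.card (MulAut (QuaternionGroup (2 ^ (n - 2) * s))) =
      2 ^ (2 * n - 3) * s * Nat.totient s ∧
    Nat.card (MulAut (DihedralGroup (2 ^ (n - 1) * s))) =
      2 ^ (2 * n - 3) * s * Nat.totient s := by
  obtain ⟨k, rfl⟩ : ∃ k, n = k + 2 := ⟨n - 2, by omega⟩
  have e1 : k + 2 - 2 = k := by omega
  have e2 : k + 2 - 1 = k + 1 := by omega
  have e3 : 2 * (k + 2) - 3 = 2 * k + 1 := by omega
  have hp : ∀ j : ℕ, 3 ≤ 2 ^ j * s := fun j =>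
    hs3.trans (Nat.le_mul_of_pos_left s (by positivity))
  have h0 : 0 < 2 ^ k * s := by have := hp k; omega
  rw [e1, e2, e3, ← AutCard.arith s k hs]
  constructor
  · rw [← Nat.card_eq_of_bijective _ (AutCard.quatAut_bijective (2 ^ k * s) h0 (hp k)),
      AutCard.card_units_prod _ (by omega)]
    have : 2 * (2 ^ k * s) = 2 ^ (k + 1) * s := by ring
    rw [this]
  · rw [← Nat.card_eq_of_bijective _ (AutCard.dihAut_bijective _ (hp (k + 1))),
      AutCard.card_units_prod _ (by have := hp (k + 1); omega)]
end
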